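/- There exist functions f_1, f_2 : ℕ → [0,∞) with f_1(L)/L → 0 and f_2(L)/L → 0 as L → ∞, and for every L ∈ ℕ a map M_L : Ω_L^PSAW → Ω_L^NE, such that: (i) for every ŵ ∈ Ω_L^NE the number of preimages satisfies |M_L^{−1}(ŵ)| ≤ e^{f_1(L)}, and (ii) for every w ∈ Ω_L^PSAW one has H(w) − H(M_L(w)) ≤ f_2(L). -/

import Mathlib

open Filter

/-! ## Paths on `ℤ²` encoded by direction sequences -/

/-- The four unit steps of `ℤ²`: right, left, up, down. -/
def dirs : Fin 4 → ℤ × ℤ := ![(1, 0), (-1, 0), (0, 1), (0, -1)]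

/-- The list of steps (increments) of an `L`-step path encoded by a direction sequence. -/
def stepsOf {L : ℕ} (s : Fin L → Fin 4) : List (ℤ × ℤ) := (List.ofFn s).map dirs

/-- The position `w_i` of the path after `i` steps; `w_0 = (0,0)`. -/
def pt (steps : List (ℤ × ℤ)) (i : ℕ) : ℤ × ℤ := (steps.take i).sum

/-- Self-avoiding: the sites `w_0, …, w_L` are pairwise distinct. -/
def IsSA (steps : List (ℤ × ℤ)) : Prop :=
  ∀ i ≤ steps.length, ∀ j ≤ steps.length, pt steps i = pt steps j → i = j

/-- Prudent: no step points towards a previously visited site, i.e. for every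
`i < L`, every `k ≥ 1` and every `j ≤ i`, `w_i + k (w_{i+1} - w_i) ≠ w_j`. -/
def IsPrudent (steps : List (ℤ × ℤ)) : Prop :=
  ∀ i < steps.length, ∀ k : ℕ, 1 ≤ k → ∀ j ≤ i,
    pt steps i + (k : ℤ) • steps.getD i (0, 0) ≠ pt steps j

/-- Twice the midpoint `u_{i+1}` of step number `i` (0-indexed): `w_i + w_{i+1}`. -/
def dmid (steps : List (ℤ × ℤ)) (i : ℕ) : ℤ × ℤ := pt steps i + pt steps (i + 1)

/-- The Hamiltonian `H(w)`: the number of pairs `1 ≤ i < j ≤ L` with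
`‖u_i - u_j‖ = 1`, i.e. whose doubled midpoints differ by a vector of squared
Euclidean norm `4`. -/
noncomputable def Ham (steps : List (ℤ × ℤ)) : ℕ :=
  ((Finset.range steps.length ×ˢ Finset.range steps.length).filter fun p =>
      p.1 < p.2 ∧ (dmid steps p.1 - dmid steps p.2).1 ^ 2 +
        (dmid steps p.1 - dmid steps p.2).2 ^ 2 = 4).card

/-! ## IPSAW -/

open scoped Classical in
/-- `Ω_L^PSAW`: the set of `L`-step prudent paths. -/
noncomputable def psawFinset (L : ℕ) : Finset (Fin L → Fin 4) :=
  Finset.univ.filter fun s => IsPrudent (stepsOf s)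

/-- `Z_{β,L}`: the partition function of IPSAW. -/
noncomputable def Zpsaw (β : ℝ) (L : ℕ) : ℝ :=
  ∑ s ∈ psawFinset L, Real.exp (β * (Ham (stepsOf s) : ℝ))

/-! ## Partially directed paths, oriented blocks and NE-prudent paths -/

/-- The vertical run of steps corresponding to a (signed) stretch `ℓ`. -/
def vrun (ℓ : ℤ) : List (ℤ × ℤ) := List.replicate ℓ.natAbs (if 0 ≤ ℓ then (0, 1) else (0, -1))

/-- The horizontal run of steps corresponding to a (signed) stretch `ℓ`. -/
def hrun (ℓ : ℤ) : List (ℤ × ℤ) := List.replicate ℓ.natAbs (if 0 ≤ ℓ then (1, 0) else (-1, 0))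

/-- The west-east partially directed path with stretch sequence `ℓs`: vertical
runs separated by single horizontal inter-stretch steps. -/
def weSteps (ℓs : List ℤ) : List (ℤ × ℤ) := List.intercalate [(1, 0)] (ℓs.map vrun)

/-- The south-north partially directed path with stretch sequence `ℓs`: horizontal
runs separated by single vertical inter-stretch steps. -/
def snSteps (ℓs : List ℤ) : List (ℤ × ℤ) := List.intercalate [(0, 1)] (ℓs.map hrun)

/-- The upper exit condition: `ℓ_1 + ⋯ + ℓ_N > max_{0 ≤ i < N} (ℓ_1 + ⋯ + ℓ_i)`. -/
def upperExit (ℓs : List ℤ) : Prop := ∀ i < ℓs.length, (ℓs.take i).sum < ℓs.sum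

/-- A block of given type: `true` = west-east, `false` = south-north. -/
def blockSteps : Bool → List ℤ → List (ℤ × ℤ)
  | true, ℓs => weSteps ℓs
  | false, ℓs => snSteps ℓs

/-- The concatenation of a sequence of blocks of alternating type, starting with
type `b`. -/
def neSteps : Bool → List (List ℤ) → List (ℤ × ℤ)
  | _, [] => []
  | b, ℓs :: rest => blockSteps b ℓs ++ neSteps (!b) rest

/-- Block data of an NE-prudent path: a nonempty sequence of nonempty stretch
sequences, all blocks but the last satisfying the upper exit condition, and all
blocks but the first having a negative first stretch. -/
def IsNEData (bs : List (List ℤ)) : Prop :=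
  bs ≠ [] ∧ (∀ ℓs ∈ bs, ℓs ≠ []) ∧
  (∀ i : ℕ, i + 1 < bs.length → upperExit (bs.getD i [])) ∧
  (∀ i : ℕ, 0 < i → i < bs.length → (bs.getD i []).headI < 0)

/-- An NE-prudent path: a prudent path obtained as the concatenation of oriented
blocks of alternating type as prescribed by `IsNEData`. -/
def IsNEPath (steps : List (ℤ × ℤ)) : Prop :=
  IsPrudent steps ∧ ∃ (b : Bool) (bs : List (List ℤ)), IsNEData bs ∧ neSteps b bs = steps

open scoped Classical in
/-- `Ω_L^NE`: the set of `L`-step NE-prudent paths. -/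
noncomputable def neFinset (L : ℕ) : Finset (Fin L → Fin 4) :=
  Finset.univ.filter fun s => IsNEPath (stepsOf s)

/-- `Z^NE_{β,L}`: the partition function of NE-IPSAW. -/
noncomputable def Zne (β : ℝ) (L : ℕ) : ℝ :=
  ∑ s ∈ neFinset L, Real.exp (β * (Ham (stepsOf s) : ℝ))

/-! ## Starred and tilde NE sets -/

/-- Block data where all blocks, including the last one, satisfy the upper exit
condition. -/
def IsNEStarData (bs : List (List ℤ)) : Prop :=
  bs ≠ [] ∧ (∀ ℓs ∈ bs, ℓs ≠ []) ∧
  (∀ i : ℕ, i < bs.length → upperExit (bs.getD i [])) ∧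
  (∀ i : ℕ, 0 < i → i < bs.length → (bs.getD i []).headI < 0)

/-- Membership in `Ω_L^{NE,*}`. -/
def IsNEStar (steps : List (ℤ × ℤ)) : Prop :=
  IsPrudent steps ∧ ∃ (b : Bool) (bs : List (List ℤ)), IsNEStarData bs ∧ neSteps b bs = steps

/-- Membership in `Ω̃_L^{NE,*}`: moreover the first stretch of the path has length `0`. -/
def IsNETilde (steps : List (ℤ × ℤ)) : Prop :=
  IsPrudent steps ∧ ∃ (b : Bool) (bs : List (List ℤ)), IsNEStarData bs ∧
    bs.headI.headI = 0 ∧ neSteps b bs = steps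

open scoped Classical in
noncomputable def neStarFinset (L : ℕ) : Finset (Fin L → Fin 4) :=
  Finset.univ.filter fun s => IsNEStar (stepsOf s)

open scoped Classical in
noncomputable def neTildeFinset (L : ℕ) : Finset (Fin L → Fin 4) :=
  Finset.univ.filter fun s => IsNETilde (stepsOf s)

/-- `Z^{NE,*}_{β,L}`. -/
noncomputable def Zstar (β : ℝ) (L : ℕ) : ℝ :=
  ∑ s ∈ neStarFinset L, Real.exp (β * (Ham (stepsOf s) : ℝ))

/-- `Z̃^{NE,*}_{β,L}`. -/
noncomputable def Ztilde (β : ℝ) (L : ℕ) : ℝ :=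
  ∑ s ∈ neTildeFinset L, Real.exp (β * (Ham (stepsOf s) : ℝ))

/-! ## IPDSAW and ISAW -/

/-- A west-east partially directed self-avoiding path: increments in
`{(1,0),(0,1),(0,-1)}` and self-avoiding. -/
def IsPD (steps : List (ℤ × ℤ)) : Prop :=
  (∀ d ∈ steps, d = (1, 0) ∨ d = (0, 1) ∨ d = (0, -1)) ∧ IsSA steps

open scoped Classical in
/-- `Ω_L^PDSAW`. -/
noncomputable def pdFinset (L : ℕ) : Finset (Fin L → Fin 4) :=
  Finset.univ.filter fun s => IsPD (stepsOf s)

/-- `Z^IPDSAW_{β,L}`. -/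
noncomputable def Zipd (β : ℝ) (L : ℕ) : ℝ :=
  ∑ s ∈ pdFinset L, Real.exp (β * (Ham (stepsOf s) : ℝ))

open scoped Classical in
/-- `Ω_L^SAW`. -/
noncomputable def sawFinset (L : ℕ) : Finset (Fin L → Fin 4) :=
  Finset.univ.filter fun s => IsSA (stepsOf s)

/-- `Z^ISAW_{β,L}`. -/
noncomputable def Zisaw (β : ℝ) (L : ℕ) : ℝ :=
  ∑ s ∈ sawFinset L, Real.exp (β * (Ham (stepsOf s) : ℝ))

/-! ## Orientations of two-sided paths -/

/-- The four possible general orientations of a two-sided prudent path. -/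
inductive Orient | NE | NW | SE | SW
deriving DecidableEq

/-- The axial symmetry of `ℤ²` turning an NE-oriented object into an
`x`-oriented one, acting on steps. -/
def osym : Orient → ℤ × ℤ → ℤ × ℤ
  | Orient.NE, d => d
  | Orient.NW, d => (-d.1, d.2)
  | Orient.SE, d => (d.1, -d.2)
  | Orient.SW, d => (-d.1, -d.2)

/-! ## Touchings of integer sequences -/

/-- Steps `i` and `j` of the lattice path with coordinates `x`, `y` have midpoints at distance 1. -/
def Touch (x y : ℕ → ℤ) (i j : ℕ) : Prop :=
  (x i + x (i + 1) - (x j + x (j + 1))) ^ 2 + (y i + y (i + 1) - (y j + y (j + 1))) ^ 2 = 4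

instance (x y : ℕ → ℤ) (i j : ℕ) : Decidable (Touch x y i j) :=
  inferInstanceAs (Decidable (_ = _))

/-- The number of steps in `[a, b)` touching step `j`. -/
def touchCount (x y : ℕ → ℤ) (a b j : ℕ) : ℕ :=
  ((Finset.Ico a b).filter fun i => Touch x y i j).card

/-- The list of increments of the path with coordinates `x`, `y` during `[s, t)`. -/
def seg (x y : ℕ → ℤ) (s t : ℕ) : List (ℤ × ℤ) :=
  (List.range' s (t - s)).map fun i => (x (i + 1) - x i, y (i + 1) - y i)

@[simp] lemma length_seg (x y : ℕ → ℤ) (s t : ℕ) : (seg x y s t).length = t - s := by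
  simp [seg]

lemma seg_append (x y : ℕ → ℤ) {s t u : ℕ} (h1 : s ≤ t) (h2 : t ≤ u) :
    seg x y s t ++ seg x y t u = seg x y s u := by
  unfold seg
  rw [← List.map_append]
  have : List.range' t (u - t) = List.range' (s + 1 * (t - s)) (u - t) := by
    congr 1; omega
  rw [this, List.range'_append]
  congr 2; omega

lemma seg_cons (x y : ℕ → ℤ) {s t : ℕ} (h : s < t) :
    seg x y s t = (x (s + 1) - x s, y (s + 1) - y s) :: seg x y (s + 1) t := by
  unfold seg
  have : t - s = (t - (s + 1)) + 1 := by omega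
  rw [this, List.range'_succ, List.map_cons]

lemma seg_self (x y : ℕ → ℤ) (s : ℕ) : seg x y s s = [] := by simp [seg]

lemma mem_seg {x y : ℕ → ℤ} {s t : ℕ} {d : ℤ × ℤ} (h : d ∈ seg x y s t) :
    ∃ i, s ≤ i ∧ i < t ∧ d = (x (i + 1) - x i, y (i + 1) - y i) := by
  simp only [seg, List.mem_map, List.mem_range'_1] at h
  obtain ⟨i, hi, rfl⟩ := h
  exact ⟨i, hi.1, by omega, rfl⟩

lemma pt_succ (l : List (ℤ × ℤ)) {i : ℕ} (h : i < l.length) :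
    pt l (i + 1) = pt l i + l[i] := by
  unfold pt
  rw [List.take_add_one, List.getElem?_eq_getElem h, List.sum_append]
  simp

lemma pt_seg (x y : ℕ → ℤ) (s t i : ℕ) (h : i ≤ t - s) :
    pt (seg x y s t) i = (x (s + i) - x s, y (s + i) - y s) := by
  induction i with
  | zero => simp [pt, Prod.ext_iff]
  | succ i ih =>
    rw [pt_succ _ (by simp; omega), ih (by omega)]
    simp [seg, ← add_assoc]

lemma eq_seg_pt (c : List (ℤ × ℤ)) :
    seg (fun i => (pt c i).1) (fun i => (pt c i).2) 0 c.length = c := by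
  apply List.ext_getElem
  · simp
  · intro i h1 h2
    simp [seg, pt_succ _ h2]

lemma ham_seg (x y : ℕ → ℤ) (s t : ℕ) :
    Ham (seg x y s t) = ∑ j ∈ Finset.Ico s t, touchCount x y s j j := by
  unfold Ham
  rw [length_seg, Finset.card_filter, Finset.sum_product_right,
    Finset.sum_Ico_eq_sum_range]
  refine Finset.sum_congr rfl fun j hj => ?_
  rw [Finset.mem_range] at hj
  unfold touchCount
  rw [← Finset.card_filter]
  symm
  refine Finset.card_bij' (fun i _ => i - s) (fun i _ => s + i) ?_ ?_ ?_ ?_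
  · intro i hi
    simp only [Finset.mem_filter, Finset.mem_Ico, Finset.mem_range] at hi ⊢
    refine ⟨by omega, by omega, ?_⟩
    have h := hi.2
    unfold Touch at h
    simp only [dmid]
    rw [pt_seg _ _ _ _ _ (by omega), pt_seg _ _ _ _ _ (by omega), pt_seg _ _ _ _ _ (by omega),
      pt_seg _ _ _ _ _ (by omega)]
    have e : s + (i - s) = i := by omega
    have e2 : s + (i - s + 1) = i + 1 := by omega
    rw [e, e2, ← h, ← add_assoc]
    simp only [Prod.fst_sub, Prod.fst_add, Prod.snd_sub, Prod.snd_add]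
    ring
  · intro i hi
    simp only [Finset.mem_filter, Finset.mem_Ico, Finset.mem_range] at hi ⊢
    refine ⟨by omega, ?_⟩
    have h := hi.2.2
    simp only [dmid] at h
    rw [pt_seg _ _ _ _ _ (by omega), pt_seg _ _ _ _ _ (by omega), pt_seg _ _ _ _ _ (by omega),
      pt_seg _ _ _ _ _ (by omega)] at h
    unfold Touch
    rw [← h]
    simp only [Prod.fst_sub, Prod.fst_add, Prod.snd_sub, Prod.snd_add, ← add_assoc]
    ring
  · intro i hi
    simp only [Finset.mem_filter, Finset.mem_Ico] at hi
    omega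
  · intro i hi
    omega

lemma touchCount_split (x y : ℕ → ℤ) {a b c : ℕ} (j : ℕ) (h1 : a ≤ b) (h2 : b ≤ c) :
    touchCount x y a c j = touchCount x y a b j + touchCount x y b c j := by
  unfold touchCount
  rw [← Finset.Ico_union_Ico_eq_Ico h1 h2, Finset.filter_union, Finset.card_union_of_disjoint]
  exact Finset.disjoint_filter_filter (Finset.Ico_disjoint_Ico_consecutive a b c)

/-- The energy of a concatenation: internal energies plus touchings between the two parts. -/
lemma ham_append (u v : List (ℤ × ℤ)) :
    Ham (u ++ v) = Ham u + Ham v +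
      ∑ j ∈ Finset.Ico u.length (u ++ v).length,
        touchCount (fun i => (pt (u ++ v) i).1) (fun i => (pt (u ++ v) i).2) 0 u.length j := by
  set x : ℕ → ℤ := fun i => (pt (u ++ v) i).1 with hx
  set y : ℕ → ℤ := fun i => (pt (u ++ v) i).2 with hy
  have hw : seg x y 0 (u ++ v).length = u ++ v := eq_seg_pt (u ++ v)
  have hl : u.length ≤ (u ++ v).length := by simp
  have hsplit := seg_append x y (Nat.zero_le u.length) hl
  rw [hw] at hsplit
  obtain ⟨hu, hv⟩ := List.append_inj hsplit (by simp)
  conv_lhs => rw [← hw]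
  conv_rhs => rw [← hu, ← hv]
  rw [ham_seg, ham_seg, ham_seg, ← Finset.sum_Ico_consecutive _ (Nat.zero_le u.length) hl,
    seg_append x y (Nat.zero_le u.length) hl, hu]
  simp only [length_seg, Nat.sub_zero]
  rw [add_assoc, ← Finset.sum_add_distrib]
  congr 1
  refine Finset.sum_congr rfl fun j hj => ?_
  rw [Finset.mem_Ico] at hj
  rw [touchCount_split x y j (Nat.zero_le u.length) hj.1, add_comm]

lemma ham_append_ge (u v : List (ℤ × ℤ)) : Ham u + Ham v ≤ Ham (u ++ v) := by
  rw [ham_append]; omega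

/-! ## Symmetries of the lattice -/

/-- The symmetries of `ℤ²` fixing the origin and preserving the set of axes. -/
inductive LatticeSym : (ℤ × ℤ → ℤ × ℤ) → Prop
  | id : LatticeSym fun p => p
  | swap {g} : LatticeSym g → LatticeSym fun p => ((g p).2, (g p).1)
  | neg {g} : LatticeSym g → LatticeSym fun p => (-(g p).1, (g p).2)

lemma ham_map_swap (c : List (ℤ × ℤ)) : Ham (c.map fun p => (p.2, p.1)) = Ham c := by
  have hpt : ∀ i, pt (c.map fun p => (p.2, p.1)) i = ((pt c i).2, (pt c i).1) := by
    intro i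
    simp only [pt, ← List.map_take]
    induction c.take i with
    | nil => rfl
    | cons a l ih => simp [ih]
  unfold Ham
  simp only [dmid, hpt, List.length_map, Prod.fst_sub, Prod.fst_add, Prod.snd_sub, Prod.snd_add]
  congr 1
  refine Finset.filter_congr fun p _ => ?_
  rw [add_comm]

lemma ham_map_neg (c : List (ℤ × ℤ)) : Ham (c.map fun p => (-p.1, p.2)) = Ham c := by
  have hpt : ∀ i, pt (c.map fun p => (-p.1, p.2)) i = (-(pt c i).1, (pt c i).2) := by
    intro i
    simp only [pt, ← List.map_take]
    induction c.take i with
    | nil => rfl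
    | cons a l ih => simp [ih]; ring
  unfold Ham
  simp only [dmid, hpt, List.length_map, Prod.fst_sub, Prod.fst_add, Prod.snd_sub, Prod.snd_add]
  congr 1
  refine Finset.filter_congr fun p _ => ?_
  constructor <;> rintro ⟨h1, h2⟩ <;> refine ⟨h1, ?_⟩ <;> rw [← h2] <;> ring

lemma LatticeSym.ham_map {g : ℤ × ℤ → ℤ × ℤ} (hg : LatticeSym g) (c : List (ℤ × ℤ)) :
    Ham (c.map g) = Ham c := by
  induction hg with
  | id => simp
  | @swap g _ ih =>
    have : c.map (fun p => ((g p).2, (g p).1)) = (c.map g).map fun p => (p.2, p.1) := by simp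
    rw [this, ham_map_swap, ih]
  | @neg g _ ih =>
    have : c.map (fun p => (-(g p).1, (g p).2)) = (c.map g).map fun p => (-p.1, p.2) := by simp
    rw [this, ham_map_neg, ih]

/-- A symmetry permutes the four unit steps. -/
lemma LatticeSym.exists_perm {g : ℤ × ℤ → ℤ × ℤ} (hg : LatticeSym g) :
    ∃ k : Equiv.Perm (Fin 4), ∀ d, g (dirs d) = dirs (k d) := by
  induction hg with
  | id => exact ⟨1, fun d => rfl⟩
  | @swap g _ ih =>
    obtain ⟨k, hk⟩ := ih
    refine ⟨k.trans (Equiv.swap 0 2 * Equiv.swap 1 3), fun d => ?_⟩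
    simp only [hk, Equiv.trans_apply]
    generalize k d = e
    revert e; decide
  | @neg g _ ih =>
    obtain ⟨k, hk⟩ := ih
    refine ⟨k.trans (Equiv.swap 0 1), fun d => ?_⟩
    simp only [hk, Equiv.trans_apply]
    generalize k d = e
    revert e; decide

lemma LatticeSym.comp_swap {g : ℤ × ℤ → ℤ × ℤ} (hg : LatticeSym g) :
    LatticeSym fun p => g (p.2, p.1) := by
  induction hg with
  | id => exact LatticeSym.swap LatticeSym.id
  | swap _ ih => exact LatticeSym.swap ih
  | neg _ ih => exact LatticeSym.neg ih

lemma LatticeSym.comp_neg {g : ℤ × ℤ → ℤ × ℤ} (hg : LatticeSym g) :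
    LatticeSym fun p => g (-p.1, p.2) := by
  induction hg with
  | id => exact LatticeSym.neg LatticeSym.id
  | swap _ ih => exact LatticeSym.swap ih
  | neg _ ih => exact LatticeSym.neg ih

/-! ## Prudent paths in coordinates -/

/-- The first `L` steps of the path with coordinates `x`, `y` form a prudent path. -/
structure PrudentSeq (x y : ℕ → ℤ) (L : ℕ) : Prop where
  step : ∀ i < L, (x (i + 1) = x i + 1 ∧ y (i + 1) = y i) ∨ (x (i + 1) = x i - 1 ∧ y (i + 1) = y i) ∨
    (x (i + 1) = x i ∧ y (i + 1) = y i + 1) ∨ (x (i + 1) = x i ∧ y (i + 1) = y i - 1)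
  east : ∀ i < L, x (i + 1) = x i + 1 → ∀ j ≤ i, y j = y i → x j ≤ x i
  west : ∀ i < L, x (i + 1) = x i - 1 → ∀ j ≤ i, y j = y i → x i ≤ x j
  north : ∀ i < L, y (i + 1) = y i + 1 → ∀ j ≤ i, x j = x i → y j ≤ y i
  south : ∀ i < L, y (i + 1) = y i - 1 → ∀ j ≤ i, x j = x i → y i ≤ y j

namespace PrudentSeq

variable {x y : ℕ → ℤ} {L : ℕ}

lemma swap (h : PrudentSeq x y L) : PrudentSeq y x L where
  step i hi := by have := h.step i hi; omega
  east := h.north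
  west := h.south
  north := h.east
  south := h.west

lemma neg (h : PrudentSeq x y L) : PrudentSeq (fun i => -x i) y L where
  step i hi := by have := h.step i hi; omega
  east i hi h1 j hj h2 := by have := h.west i hi (by omega) j hj h2; omega
  west i hi h1 j hj h2 := by have := h.east i hi (by omega) j hj h2; omega
  north i hi h1 j hj h2 := h.north i hi h1 j hj (by omega)
  south i hi h1 j hj h2 := h.south i hi h1 j hj (by omega)

lemma ne_of_lt (h : PrudentSeq x y L) {i j : ℕ} (hij : i < j) (hj : j ≤ L) :
    ¬(x i = x j ∧ y i = y j) := by
  obtain ⟨m, rfl⟩ : ∃ m, j = m + 1 := ⟨j - 1, by omega⟩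
  have hs := h.step m (by omega)
  have e := h.east m (by omega)
  have w := h.west m (by omega)
  have n := h.north m (by omega)
  have s := h.south m (by omega)
  rintro ⟨h1, h2⟩
  rcases hs with hs | hs | hs | hs
  · have := e hs.1 i (by omega) (by omega); omega
  · have := w hs.1 i (by omega) (by omega); omega
  · have := n hs.2 i (by omega) (by omega); omega
  · have := s hs.2 i (by omega) (by omega); omega

/-- A walker at the top of its past can only go down from a strictly new extreme column. -/
lemma strict_of_south (h : PrudentSeq x y L) {t : ℕ} (ht : t < L) (hmax : ∀ j ≤ t, y j ≤ y t)
    (hs : y (t + 1) = y t - 1) : (∀ j < t, x j < x t) ∨ (∀ j < t, x t < x j) := by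
  have hne : ∀ j < t, x j ≠ x t := by
    intro j hj e
    have h1 := h.south t ht hs j hj.le e
    have h2 := hmax j hj.le
    exact h.ne_of_lt hj ht.le ⟨e, by omega⟩
  rcases lt_or_ge (x 0) (x t) with h0 | h0
  · left
    intro j
    induction j with
    | zero => intro _; exact h0
    | succ j ih =>
      intro hj
      have := ih (by omega)
      have := hne (j + 1) hj
      have := h.step j (by omega)
      omega
  · right
    intro j
    induction j with
    | zero => intro hj; have := hne 0 hj; omega
    | succ j ih =>
      intro hj
      have := ih (by omega)
      have := hne (j + 1) hj
      have := h.step j (by omega)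
      omega

/-- Past touchings of a step taken along the top of the past. -/
lemma touch_cases (h : PrudentSeq x y L) {i j : ℕ} (hj : j < L) (hij : i < j)
    (hmax : ∀ m ≤ j, y m ≤ y j) (hup : y j ≤ y (j + 1)) (ht : Touch x y i j) :
    i + 1 = j ∨ (y (j + 1) = y j ∧ y i = y j - 1 ∧ y (i + 1) = y j - 1 ∧
      x i + x (i + 1) = x j + x (j + 1)) := by
  by_contra hcon
  rw [not_or] at hcon
  obtain ⟨hne, hcon⟩ := hcon
  have i1 := h.ne_of_lt hij hj.le
  have i2 := h.ne_of_lt (i := i + 1) (j := j) (by omega) hj.le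
  have si := h.step i (by omega)
  have sj := h.step j hj
  have m1 := hmax i (by omega)
  have m2 := hmax (i + 1) (by omega)
  have hab : ∀ a b : ℤ, a ^ 2 + b ^ 2 = 4 →
      (a = 2 ∧ b = 0) ∨ (a = -2 ∧ b = 0) ∨ (a = 0 ∧ b = 2) ∨ (a = 0 ∧ b = -2) := by
    intro a b hab
    have ha : -2 ≤ a ∧ a ≤ 2 := ⟨by nlinarith [sq_nonneg b], by nlinarith [sq_nonneg b]⟩
    have hb : -2 ≤ b ∧ b ≤ 2 := ⟨by nlinarith [sq_nonneg a], by nlinarith [sq_nonneg a]⟩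
    obtain ⟨ha1, ha2⟩ := ha
    obtain ⟨hb1, hb2⟩ := hb
    interval_cases a <;> interval_cases b <;> simp_all
  have hd := hab _ _ ht
  rcases sj with sj | sj | sj | sj
  · have e1 := h.east j hj sj.1 i (by omega)
    have e2 := h.east j hj sj.1 (i + 1) (by omega)
    omega
  · have e1 := h.west j hj sj.1 i (by omega)
    have e2 := h.west j hj sj.1 (i + 1) (by omega)
    omega
  · omega
  · omega

lemma touchCount_le_two (h : PrudentSeq x y L) {j : ℕ} (hj : j < L)
    (hmax : ∀ m ≤ j, y m ≤ y j) (hup : y j ≤ y (j + 1)) : touchCount x y 0 j j ≤ 2 := by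
  have hsub : (Finset.Ico 0 j).filter (fun i => Touch x y i j) ⊆
      {j - 1} ∪ (Finset.Ico 0 j).filter (fun i => y i = y j - 1 ∧ y (i + 1) = y j - 1 ∧
        x i + x (i + 1) = x j + x (j + 1)) := by
    intro i hi
    simp only [Finset.mem_filter, Finset.mem_Ico, Finset.mem_union, Finset.mem_singleton] at hi ⊢
    rcases h.touch_cases hj hi.1.2 hmax hup hi.2 with h1 | h1
    · left; omega
    · right; exact ⟨hi.1, h1.2⟩
  refine (Finset.card_le_card hsub).trans ((Finset.card_union_le _ _).trans ?_)
  rw [Finset.card_singleton]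
  have : ((Finset.Ico 0 j).filter (fun i => y i = y j - 1 ∧ y (i + 1) = y j - 1 ∧
        x i + x (i + 1) = x j + x (j + 1))).card ≤ 1 := by
    rw [Finset.card_le_one]
    have key : ∀ a b, a < b → b < j → y a = y j - 1 → y (a + 1) = y j - 1 →
        x a + x (a + 1) = x j + x (j + 1) → y b = y j - 1 → y (b + 1) = y j - 1 →
        x b + x (b + 1) = x j + x (j + 1) → False := by
      intro a b hab hb a1 a2 a3 b1 b2 b3
      have sa := h.step a (by omega)
      have sb := h.step b (by omega)
      have n1 := h.ne_of_lt hab (by omega)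
      have n2 := h.ne_of_lt (i := a) (j := b + 1) (by omega) (by omega)
      omega
    intro a ha b hb
    simp only [Finset.mem_filter, Finset.mem_Ico] at ha hb
    rcases lt_trichotomy a b with hab | hab | hab
    · exact (key a b hab hb.1.2 ha.2.1 ha.2.2.1 ha.2.2.2 hb.2.1 hb.2.2.1 hb.2.2.2).elim
    · exact hab
    · exact (key b a hab ha.1.2 hb.2.1 hb.2.2.1 hb.2.2.2 ha.2.1 ha.2.2.1 ha.2.2.2).elim
  omega

end PrudentSeq

/-- No downward step during `[s, t)`. -/
def Rising (y : ℕ → ℤ) (s t : ℕ) : Prop := ∀ i, s ≤ i → i < t → y i ≤ y (i + 1)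

lemma Rising.le {y : ℕ → ℤ} {s t : ℕ} (h : Rising y s t) {i j : ℕ} (hs : s ≤ i) (hij : i ≤ j)
    (hj : j ≤ t) : y i ≤ y j := by
  induction j, hij using Nat.le_induction with
  | base => exact le_rfl
  | succ j hij ih => exact (ih (by omega)).trans (h j (by omega) (by omega))

lemma Rising.mono {y : ℕ → ℤ} {s t s' t' : ℕ} (h : Rising y s t) (hs : s ≤ s') (ht : t' ≤ t) :
    Rising y s' t' := fun i h1 h2 => h i (by omega) (by omega)

lemma Rising.max {y : ℕ → ℤ} {s t : ℕ} (h : Rising y s t) (hs : ∀ j < s, y j ≤ y s) {i : ℕ}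
    (hi : s ≤ i) (hit : i ≤ t) : ∀ j ≤ i, y j ≤ y i := by
  intro j hj
  rcases lt_or_ge j s with hjs | hjs
  · exact (hs j hjs).trans (h.le le_rfl hi hit)
  · exact h.le hjs hj hit

/-- The total number of past touchings of the steps in `[s, t)`. -/
def addedEnergy (x y : ℕ → ℤ) (s t : ℕ) : ℕ := ∑ j ∈ Finset.Ico s t, touchCount x y 0 j j

/-- The number of touchings between the steps in `[s, t)` and those before `s`. -/
def pastEnergy (x y : ℕ → ℤ) (s t : ℕ) : ℕ := ∑ j ∈ Finset.Ico s t, touchCount x y 0 s j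

lemma addedEnergy_eq (x y : ℕ → ℤ) (s t : ℕ) :
    addedEnergy x y s t = Ham (seg x y s t) + pastEnergy x y s t := by
  unfold addedEnergy pastEnergy
  rw [ham_seg, ← Finset.sum_add_distrib]
  refine Finset.sum_congr rfl fun j hj => ?_
  rw [Finset.mem_Ico] at hj
  rw [touchCount_split x y j (Nat.zero_le s) hj.1, add_comm]

lemma addedEnergy_add (x y : ℕ → ℤ) {s t u : ℕ} (h1 : s ≤ t) (h2 : t ≤ u) :
    addedEnergy x y s t + addedEnergy x y t u = addedEnergy x y s u :=
  Finset.sum_Ico_consecutive _ h1 h2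

lemma addedEnergy_le_of_rising {x y : ℕ → ℤ} {L s t : ℕ} (h : PrudentSeq x y L) (ht : t ≤ L)
    (hr : Rising y s t) (hs : ∀ j < s, y j ≤ y s) : addedEnergy x y s t ≤ 2 * (t - s) := by
  unfold addedEnergy
  calc _ ≤ ∑ j ∈ Finset.Ico s t, 2 := by
        refine Finset.sum_le_sum fun j hj => ?_
        rw [Finset.mem_Ico] at hj
        exact h.touchCount_le_two (by omega) (hr.max hs hj.1 hj.2.le) (hr j hj.1 hj.2)
    _ = _ := by simp [mul_comm]

/-- Starting from a strictly new top row, only the first row and the following step touch the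
past. -/
lemma pastEnergy_le_of_rising {x y : ℕ → ℤ} {L s t k : ℕ} (h : PrudentSeq x y L) (ht : t ≤ L)
    (hr : Rising y s t) (hs : ∀ j < s, y j < y s)
    (hk : s + k < t → y s < y (s + k + 1)) : pastEnergy x y s t ≤ 2 * k + 2 := by
  unfold pastEnergy
  calc _ ≤ ∑ j ∈ Finset.Ico s t, if j < s + k + 1 then 2 else 0 := by
        refine Finset.sum_le_sum fun j hj => ?_
        rw [Finset.mem_Ico] at hj
        have hm := hr.max (fun j hj => (hs j hj).le) hj.1 hj.2.le
        split_ifs with hjk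
        · have := touchCount_split x y j (Nat.zero_le s) hj.1
          have := h.touchCount_le_two (by omega) hm (hr j hj.1 hj.2)
          omega
        · rw [Nat.le_zero, touchCount, Finset.card_eq_zero, Finset.filter_eq_empty_iff]
          intro i hi hT
          rw [Finset.mem_Ico] at hi
          have h1 := hs i hi.2
          have h2 := hk (by omega)
          have h3 := hr.le (i := s + k + 1) (j := j) (by omega) (by omega) (by omega)
          rcases h.touch_cases (by omega) (by omega) hm (hr j hj.1 hj.2) hT with h4 | h4 <;> omega
    _ ≤ 2 * k + 2 := by
        rw [← Finset.sum_filter, Finset.sum_const, smul_eq_mul]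
        have : ((Finset.Ico s t).filter (fun j => j < s + k + 1)).card ≤ (Finset.Ico s (s + k + 1)).card := by
          apply Finset.card_le_card
          intro j hj
          simp only [Finset.mem_filter, Finset.mem_Ico] at hj ⊢
          omega
        rw [Nat.card_Ico] at this
        omega

/-- The maximal horizontal run starting at time `s`. -/
lemma exists_row {x y : ℕ → ℤ} {L s t : ℕ} (h : PrudentSeq x y L) (hst : s ≤ t) (ht : t ≤ L)
    (hr : Rising y s t) : ∃ k, s + k ≤ t ∧ (∀ i, s ≤ i → i < s + k → y (i + 1) = y i ∧
      x (i + 1) - x i = x (s + 1) - x s) ∧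
      (s + k < t → x (s + k + 1) = x (s + k) ∧ y (s + k + 1) = y (s + k) + 1) := by
  classical
  have hex : ∃ k, s + k = t ∨ y (s + k + 1) = y (s + k) + 1 := ⟨t - s, by omega⟩
  obtain ⟨k, hk, hmin⟩ : ∃ k, (s + k = t ∨ y (s + k + 1) = y (s + k) + 1) ∧
      ∀ m < k, ¬(s + m = t ∨ y (s + m + 1) = y (s + m) + 1) :=
    ⟨Nat.find hex, Nat.find_spec hex, fun _ => Nat.find_min hex⟩
  have hkt : s + k ≤ t := by
    by_contra hcon
    exact hmin (t - s) (by omega) (by omega)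
  have hflat : ∀ m < k, y (s + m + 1) = y (s + m) := by
    intro m hm
    have h1 := hmin m hm
    have h2 := h.step (s + m) (by omega)
    have h3 := hr (s + m) (by omega) (by omega)
    omega
  refine ⟨k, hkt, ?_, fun hlt => ?_⟩
  · intro i hi
    induction i, hi using Nat.le_induction with
    | base => intro h1; exact ⟨hflat 0 (by omega), rfl⟩
    | succ i hi ih =>
      intro h1
      have h2 := ih (by omega)
      have h3 := hflat (i + 1 - s) (by omega)
      have e : s + (i + 1 - s) = i + 1 := by omega
      rw [e] at h3
      have h4 := h.step i (by omega)
      have h5 := h.step (i + 1) (by omega)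
      have h6 := h.ne_of_lt (i := i) (j := i + 1 + 1) (by omega) (by omega)
      omega
  · have := h.step (s + k) (by omega)
    omega

/-! ## Decompositions into chunks -/

/-- A word over the steps east, north and south without immediate reversals. -/
def PDWord (l : List (ℤ × ℤ)) : Prop :=
  (∀ d ∈ l, d = (1, 0) ∨ d = (0, 1) ∨ d = (0, -1)) ∧ l.IsChain fun a b => a + b ≠ 0

/-- A sequence of oriented blocks, all with a negative first stretch and the upper exit
condition. -/
def Genuine (bs : List (List ℤ)) : Prop :=
  ∀ ℓs ∈ bs, ℓs ≠ [] ∧ ℓs.headI < 0 ∧ upperExit ℓs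

/-- The kinds of pieces a prudent path is cut into: straight lines, partially directed pieces and
sequences of oriented blocks. -/
inductive Kind
  | line
  | pd
  | ne

/-- The word `l` is, up to a symmetry of the lattice, a piece of the given kind. -/
def ValidChunk : Kind × List (ℤ × ℤ) → Prop
  | (.line, l) => ∃ (d : Fin 4) (n : ℕ), l = List.replicate n (dirs d)
  | (.pd, l) => ∃ g, LatticeSym g ∧ PDWord (l.map g)
  | (.ne, l) => ∃ g, LatticeSym g ∧ ∃ bs, Genuine bs ∧ neSteps true bs = l.map g

/-- The energy credited to a chunk. -/
noncomputable def chunkEnergy : Kind × List (ℤ × ℤ) → ℕ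
  | (.line, l) => 2 * l.length
  | (.pd, l) => Ham l
  | (.ne, l) => Ham l

/-- The number of line steps demanded by a chunk. -/
def chunkDemand : Kind × List (ℤ × ℤ) → ℤ
  | (.line, l) => -l.length
  | (.pd, _) => 2
  | (.ne, _) => 0

/-- The word `v` splits into at most `N` chunks, whose energies add up to `X` up to an error `E`,
and whose demands add up to at most `δ`. -/
def Decomp (v : List (ℤ × ℤ)) (N E X : ℕ) (δ : ℤ) : Prop :=
  ∃ cs : List (Kind × List (ℤ × ℤ)), (cs.map Prod.snd).flatten = v ∧ (∀ p ∈ cs, ValidChunk p) ∧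
    cs.length ≤ N ∧ X ≤ (cs.map chunkEnergy).sum + E ∧ (cs.map chunkDemand).sum ≤ δ

namespace Decomp

variable {v v' : List (ℤ × ℤ)} {N N' E E' X X' : ℕ} {δ δ' : ℤ}

lemma nil : Decomp [] 0 0 0 0 := ⟨[], by simp⟩

lemma mono (h : Decomp v N E X δ) (hN : N ≤ N') (hE : E ≤ E') (hX : X' ≤ X) (hδ : δ ≤ δ') :
    Decomp v N' E' X' δ' := by
  obtain ⟨cs, h1, h2, h3, h4, h5⟩ := h
  exact ⟨cs, h1, h2, by omega, by omega, by omega⟩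

lemma append (h : Decomp v N E X δ) (h' : Decomp v' N' E' X' δ') :
    Decomp (v ++ v') (N + N') (E + E') (X + X') (δ + δ') := by
  obtain ⟨cs, h1, h2, h3, h4, h5⟩ := h
  obtain ⟨cs', h1', h2', h3', h4', h5'⟩ := h'
  refine ⟨cs ++ cs', by simp [h1, h1'], ?_, by simp; omega, by simp; omega, by simp; omega⟩
  intro p hp
  rcases List.mem_append.1 hp with hp | hp
  exacts [h2 p hp, h2' p hp]

lemma line {d : Fin 4} {n : ℕ} (hX : X ≤ 2 * n) :
    Decomp (List.replicate n (dirs d)) 1 0 X (-n) :=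
  ⟨[(.line, List.replicate n (dirs d))], by simp,
    List.forall_mem_singleton.2 ⟨d, n, rfl⟩, by simp,
    by simpa [chunkEnergy] using hX, by simp [chunkDemand]⟩

lemma pd {g : ℤ × ℤ → ℤ × ℤ} (hg : LatticeSym g) (hv : PDWord (v.map g)) (hX : X ≤ Ham v + E) :
    Decomp v 1 E X 2 :=
  ⟨[(.pd, v)], by simp, by simpa [ValidChunk] using ⟨g, hg, hv⟩, by simp,
    by simpa [chunkEnergy] using hX, by simp [chunkDemand]⟩

lemma ne {g : ℤ × ℤ → ℤ × ℤ} {bs : List (List ℤ)} (hg : LatticeSym g) (hb : Genuine bs)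
    (hv : neSteps true bs = v.map g) (hX : X ≤ Ham v + E) : Decomp v 1 E X 0 :=
  ⟨[(.ne, v)], by simp, by simpa [ValidChunk] using ⟨g, hg, bs, hb, hv⟩, by simp,
    by simpa [chunkEnergy] using hX, by simp [chunkDemand]⟩

lemma map_of_sym {g : ℤ × ℤ → ℤ × ℤ} (hdir : ∀ d, ∃ d', g (dirs d) = dirs d')
    (hinv : ∀ p, g (g p) = p) (hham : ∀ l, Ham (l.map g) = Ham l)
    (hcomp : ∀ f, LatticeSym f → LatticeSym (f ∘ g)) (h : Decomp v N E X δ) :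
    Decomp (v.map g) N E X δ := by
  obtain ⟨cs, h1, h2, h3, h4, h5⟩ := h
  have hmap : ∀ (f : ℤ × ℤ → ℤ × ℤ) (l : List (ℤ × ℤ)), (l.map g).map (f ∘ g) = l.map f := by
    intro f l
    simp [hinv]
  refine ⟨cs.map fun p => (p.1, p.2.map g), ?_, ?_, by simpa using h3, ?_, ?_⟩
  · rw [← h1, List.map_flatten]
    simp [Function.comp_def]
  · intro p hp
    obtain ⟨⟨k, l⟩, hq, rfl⟩ := List.mem_map.1 hp
    have hv := h2 _ hq
    cases k with
    | line =>
      obtain ⟨d, n, rfl⟩ := hv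
      obtain ⟨d', hd'⟩ := hdir d
      exact ⟨d', n, by simp [hd']⟩
    | pd =>
      obtain ⟨f, hf, hl⟩ := hv
      exact ⟨f ∘ g, hcomp f hf, by rwa [hmap]⟩
    | ne =>
      obtain ⟨f, hf, bs, hb, hl⟩ := hv
      exact ⟨f ∘ g, hcomp f hf, bs, hb, by rwa [hmap]⟩
  · have : ((cs.map fun p => (p.1, p.2.map g)).map chunkEnergy) = cs.map chunkEnergy := by
      rw [List.map_map]
      apply List.map_congr_left
      rintro ⟨k, l⟩ -
      cases k <;> simp [chunkEnergy, hham]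
    rwa [this]
  · have : ((cs.map fun p => (p.1, p.2.map g)).map chunkDemand) = cs.map chunkDemand := by
      rw [List.map_map]
      apply List.map_congr_left
      rintro ⟨k, l⟩ -
      cases k <;> simp [chunkDemand]
    rwa [this]

variable {x y : ℕ → ℤ} {s t : ℕ}

lemma seg_swap (h : Decomp (seg x y s t) N E X δ) : Decomp (seg y x s t) N E X δ := by
  have : seg y x s t = (seg x y s t).map fun p => (p.2, p.1) := by simp [seg]
  rw [this]
  refine h.map_of_sym ?_ (fun _ => rfl) ham_map_swap fun f hf => hf.comp_swap
  intro d
  fin_cases d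
  exacts [⟨2, by simp [dirs]⟩, ⟨3, by simp [dirs]⟩, ⟨0, by simp [dirs]⟩, ⟨1, by simp [dirs]⟩]

lemma seg_neg (h : Decomp (seg x y s t) N E X δ) :
    Decomp (seg (fun i => -x i) y s t) N E X δ := by
  have : seg (fun i => -x i) y s t = (seg x y s t).map fun p => (-p.1, p.2) := by
    simp [seg]
    intros; ring
  rw [this]
  refine h.map_of_sym ?_ (fun _ => by simp) ham_map_neg fun f hf => hf.comp_neg
  intro d
  fin_cases d
  exacts [⟨1, by simp [dirs]⟩, ⟨0, by simp [dirs]⟩, ⟨2, by simp [dirs]⟩, ⟨3, by simp [dirs]⟩]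

end Decomp

lemma addedEnergy_swap (x y : ℕ → ℤ) (s t : ℕ) : addedEnergy y x s t = addedEnergy x y s t := by
  have : ∀ i j, Touch y x i j ↔ Touch x y i j := by
    intro i j
    unfold Touch
    rw [add_comm]
  simp only [addedEnergy, touchCount, this]

lemma addedEnergy_neg (x y : ℕ → ℤ) (s t : ℕ) :
    addedEnergy (fun i => -x i) y s t = addedEnergy x y s t := by
  have : ∀ i j, Touch (fun i => -x i) y i j ↔ Touch x y i j := by
    intro i j
    unfold Touch
    rw [show -x i + -x (i + 1) - (-x j + -x (j + 1)) = -(x i + x (i + 1) - (x j + x (j + 1))) by ring,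
      neg_sq]
  simp only [addedEnergy, touchCount, this]

/-- The decomposition statement for the steps of a path during `[s, t)`. -/
def SegDecomp (x y : ℕ → ℤ) (s t N E : ℕ) (δ : ℤ) : Prop :=
  Decomp (seg x y s t) N E (addedEnergy x y s t) δ

namespace SegDecomp

variable {x y : ℕ → ℤ} {s t u N N' E E' : ℕ} {δ δ' : ℤ}

lemma mono (h : SegDecomp x y s t N E δ) (hN : N ≤ N') (hE : E ≤ E') (hδ : δ ≤ δ') :
    SegDecomp x y s t N' E' δ' := Decomp.mono h hN hE le_rfl hδ

lemma append (h : SegDecomp x y s t N E δ) (h' : SegDecomp x y t u N' E' δ') (hst : s ≤ t)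
    (htu : t ≤ u) : SegDecomp x y s u (N + N') (E + E') (δ + δ') := by
  have := Decomp.append h h'
  rwa [seg_append x y hst htu, addedEnergy_add x y hst htu] at this

lemma swap (h : SegDecomp x y s t N E δ) : SegDecomp y x s t N E δ := by
  unfold SegDecomp
  rw [addedEnergy_swap]
  exact Decomp.seg_swap h

lemma neg (h : SegDecomp x y s t N E δ) : SegDecomp (fun i => -x i) y s t N E δ := by
  unfold SegDecomp
  rw [addedEnergy_neg]
  exact Decomp.seg_neg h

lemma refl (x y : ℕ → ℤ) (s : ℕ) : SegDecomp x y s s 0 0 0 := by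
  unfold SegDecomp
  rw [seg_self, addedEnergy, Finset.Ico_self, Finset.sum_empty]
  exact Decomp.nil

end SegDecomp

section

variable {x y : ℕ → ℤ} {L s t : ℕ}

lemma PrudentSeq.exists_dirs (h : PrudentSeq x y L) (hs : s < L) :
    ∃ d, (x (s + 1) - x s, y (s + 1) - y s) = dirs d := by
  rcases h.step s hs with h1 | h1 | h1 | h1
  · exact ⟨0, by simp [dirs, h1]⟩
  · exact ⟨1, by simp [dirs, h1]⟩
  · exact ⟨2, by simp [dirs, h1]⟩
  · exact ⟨3, by simp [dirs, h1]⟩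

/-- A straight piece along the top of the past is a line chunk. -/
lemma segDecomp_line (h : PrudentSeq x y L) (ht : t ≤ L) (hst : s < t)
    (hs : ∀ j < s, y j ≤ y s) (hr : Rising y s t)
    (hline : ∀ i, s ≤ i → i < t → x (i + 1) - x i = x (s + 1) - x s ∧
      y (i + 1) - y i = y (s + 1) - y s) :
    SegDecomp x y s t 1 0 (-((t - s : ℕ) : ℤ)) := by
  obtain ⟨d, hd⟩ := h.exists_dirs (by omega : s < L)
  have : seg x y s t = List.replicate (t - s) (dirs d) := by
    rw [List.eq_replicate_iff]
    refine ⟨length_seg x y s t, fun p hp => ?_⟩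
    obtain ⟨i, h1, h2, rfl⟩ := mem_seg hp
    rw [← hd, (hline i h1 h2).1, (hline i h1 h2).2]
  unfold SegDecomp
  rw [this]
  exact Decomp.line (addedEnergy_le_of_rising h ht hr hs)

lemma isChain_seg (h : PrudentSeq x y L) (ht : t ≤ L) :
    (seg x y s t).IsChain fun a b => a + b ≠ 0 := by
  rw [List.isChain_iff_getElem]
  intro i hi
  rw [length_seg] at hi
  have := h.ne_of_lt (i := s + i) (j := s + i + 1 + 1) (by omega) (by omega)
  simp only [seg, List.getElem_map, List.getElem_range', one_mul, ne_eq, Prod.ext_iff,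
    Prod.fst_add, Prod.snd_add, Prod.fst_zero, Prod.snd_zero, ← add_assoc]
  omega

/-- A rising piece is partially directed. -/
lemma pdWord_of_rising (h : PrudentSeq x y L) (ht : t ≤ L) (hr : Rising y s t) :
    PDWord (seg y x s t) := by
  refine ⟨fun d hd => ?_, isChain_seg h.swap ht⟩
  obtain ⟨i, h1, h2, rfl⟩ := mem_seg hd
  have := h.step i (by omega)
  have := hr i h1 h2
  simp only [Prod.mk.injEq]
  omega

lemma segDecomp_pd (h : PrudentSeq x y L) (ht : t ≤ L) (hr : Rising y s t) {E : ℕ}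
    (hE : pastEnergy x y s t ≤ E) : SegDecomp x y s t 1 E 2 := by
  refine Decomp.pd (LatticeSym.swap LatticeSym.id) (g := fun p => (p.2, p.1)) ?_ ?_
  · have : (seg x y s t).map (fun p => (p.2, p.1)) = seg y x s t := by simp [seg]
    rw [this]
    exact pdWord_of_rising h ht hr
  · rw [addedEnergy_eq]; omega

/-- A rising piece starting from a strictly new top row. -/
lemma segDecomp_of_rising (h : PrudentSeq x y L) (ht : t ≤ L) {c : ℕ} (hc : 1 ≤ c) (hst : s ≤ t)
    (hr : Rising y s t) (hs : ∀ j < s, y j < y s) :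
    ∃ N, SegDecomp x y s t N (2 * c + 2) 2 ∧ c * N ≤ 2 * (t - s) + c := by
  induction hn : t - s using Nat.strong_induction_on generalizing s with
  | _ n ih =>
    obtain ⟨k, hk, hrow, hup⟩ := exists_row h hst ht hr
    have hconst : ∀ m ≤ k, y (s + m) = y s := by
      intro m
      induction m with
      | zero => intro; rfl
      | succ m ihm =>
        intro hm
        rw [← ihm (by omega)]
        exact (hrow (s + m) (by omega) (by omega)).1
    rcases lt_or_ge k c with hkc | hkc
    · refine ⟨1, segDecomp_pd h ht hr (E := 2 * c + 2) ?_, by omega⟩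
      refine (pastEnergy_le_of_rising (k := k) h ht hr hs fun h1 => ?_).trans (by omega)
      have := hup h1
      have := hconst k le_rfl
      omega
    · have hline := segDecomp_line (t := s + k) h (by omega) (by omega) (fun j hj => (hs j hj).le)
        (hr.mono le_rfl (by omega)) fun i h1 h2 => by
          have := hrow i h1 h2
          have := hrow s le_rfl (by omega)
          omega
      rcases hk.eq_or_lt with hkt | hkt
      · subst hkt
        exact ⟨1, hline.mono le_rfl (by omega) (by omega), by omega⟩
      · have hstep := segDecomp_line (s := s + k) (t := s + k + 1) h (by omega) (by omega)
          (fun j hj => hr.max (fun j hj => (hs j hj).le) (by omega) (by omega) j hj.le)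
          (hr.mono (by omega) (by omega)) fun i h1 h2 => by
            obtain rfl : i = s + k := by omega
            exact ⟨rfl, rfl⟩
        obtain ⟨N, h1, h2⟩ := ih (t - (s + k + 1)) (by omega) (s := s + k + 1) (by omega)
          (hr.mono (by omega) le_rfl) (fun j hj => by
            have := hr.max (fun j hj => (hs j hj).le) (i := s + k) (by omega) (by omega) j (by omega)
            have := hup hkt
            omega) rfl
        refine ⟨1 + 1 + N, ((hline.append hstep (by omega) (by omega)).append h1 (by omega)
          (by omega)).mono le_rfl (by omega) (by omega), ?_⟩
        rw [mul_add, mul_add]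
        omega

end

/-! ## Stretch sequences of partially directed words -/

lemma pt_append_right (u v : List (ℤ × ℤ)) (m : ℕ) :
    pt (u ++ v) (u.length + m) = u.sum + pt v m := by
  unfold pt
  rw [List.take_length_add_append, List.sum_append]

lemma pt_append_left (u v : List (ℤ × ℤ)) {m : ℕ} (h : m ≤ u.length) :
    pt (u ++ v) m = pt u m := by
  simp [pt, List.take_append_of_le_length h]

lemma pt_length (u : List (ℤ × ℤ)) : pt u u.length = u.sum := by simp [pt]

lemma sum_vrun (ℓ : ℤ) : (vrun ℓ).sum = (0, ℓ) := by
  unfold vrun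
  split_ifs with h
  · simp [abs_of_nonneg h]
  · simp [abs_of_neg (not_le.1 h)]

lemma weSteps_singleton (ℓ : ℤ) : weSteps [ℓ] = vrun ℓ := by
  simp [weSteps]

lemma weSteps_cons_cons (ℓ ℓ' : ℤ) (ℓs : List ℤ) :
    weSteps (ℓ :: ℓ' :: ℓs) = vrun ℓ ++ (1, 0) :: weSteps (ℓ' :: ℓs) := by
  simp [weSteps]

lemma exists_weSteps_cons (ℓs : List ℤ) :
    ∃ R, ∀ ℓ, weSteps (ℓ :: ℓs) = vrun ℓ ++ R := by
  cases ℓs with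
  | nil => exact ⟨[], fun ℓ => by simp [weSteps_singleton]⟩
  | cons ℓ' ℓs => exact ⟨_, fun ℓ => weSteps_cons_cons ℓ ℓ' ℓs⟩

lemma vrun_add_one {ℓ : ℤ} (h : 0 ≤ ℓ) : vrun (ℓ + 1) = (0, 1) :: vrun ℓ := by
  unfold vrun
  rw [show (ℓ + 1).natAbs = ℓ.natAbs + 1 by omega, if_pos h, if_pos (by omega),
    List.replicate_succ]

lemma vrun_sub_one {ℓ : ℤ} (h : ℓ ≤ 0) : vrun (ℓ - 1) = (0, -1) :: vrun ℓ := by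
  unfold vrun
  rw [show (ℓ - 1).natAbs = ℓ.natAbs + 1 by omega, if_neg (by omega)]
  rcases h.eq_or_lt with rfl | h
  · rfl
  · rw [if_neg (by omega), List.replicate_succ]

/-- A partially directed word has a stretch sequence, and the sign of the first stretch is read off
the first step. -/
lemma PDWord.exists_stretches {l : List (ℤ × ℤ)} (h : PDWord l) :
    ∃ ℓ ℓs, weSteps (ℓ :: ℓs) = l ∧ (ℓ < 0 ↔ l.head? = some (0, -1)) ∧
      (0 < ℓ ↔ l.head? = some (0, 1)) := by
  induction l with
  | nil => exact ⟨0, [], by simp [weSteps_singleton, vrun]⟩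
  | cons d l ih =>
    obtain ⟨h1, h2⟩ := h
    obtain ⟨ℓ, ℓs, h3, h4, h5⟩ := ih ⟨fun d hd => h1 d (List.mem_cons_of_mem _ hd), h2.of_cons⟩
    obtain ⟨R, hR⟩ := exists_weSteps_cons ℓs
    rw [List.isChain_cons] at h2
    rcases h1 d List.mem_cons_self with rfl | rfl | rfl
    · exact ⟨0, ℓ :: ℓs, by simp [weSteps_cons_cons, vrun, h3], by simp, by simp⟩
    · have : 0 ≤ ℓ := by
        by_contra hcon
        exact h2.1 (0, -1) (h4.1 (by omega)) rfl
      refine ⟨ℓ + 1, ℓs, by rw [hR, vrun_add_one this, ← h3, hR, List.cons_append], ?_, ?_⟩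
      · simp; omega
      · simp; omega
    · have : ℓ ≤ 0 := by
        by_contra hcon
        exact h2.1 (0, 1) (h5.1 (by omega)) rfl
      refine ⟨ℓ - 1, ℓs, by rw [hR, vrun_sub_one this, ← h3, hR, List.cons_append], ?_, ?_⟩
      · simp; omega
      · simp; omega

lemma sum_weSteps_snd (ℓs : List ℤ) : (weSteps ℓs).sum.2 = ℓs.sum := by
  induction ℓs with
  | nil => simp [weSteps]
  | cons ℓ ℓs ih =>
    cases ℓs with
    | nil => simp [weSteps_singleton, sum_vrun]
    | cons ℓ' ℓs => simp [weSteps_cons_cons, sum_vrun, ih]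

lemma exists_pt_weSteps (ℓs : List ℤ) {i : ℕ} (hi : i < ℓs.length) :
    ∃ m, (pt (weSteps ℓs) m).2 = (ℓs.take i).sum ∧ (m < (weSteps ℓs).length ∨ i = 0 ∧ m = 0) := by
  induction ℓs generalizing i with
  | nil => simp at hi
  | cons ℓ ℓs ih =>
    cases i with
    | zero => exact ⟨0, by simp [pt]⟩
    | succ i =>
      cases ℓs with
      | nil => simp at hi
      | cons ℓ' ℓs =>
        rw [weSteps_cons_cons]
        obtain ⟨m, h1, h2⟩ := ih (i := i) (by simpa using hi)
        rcases h2 with h2 | ⟨rfl, rfl⟩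
        · refine ⟨(vrun ℓ).length + (m + 1), ?_, Or.inl (by simp; omega)⟩
          rw [pt_append_right, sum_vrun, List.take_succ_cons, List.sum_cons, ← h1]
          simp [pt]
        · refine ⟨(vrun ℓ).length + 0, ?_, Or.inl (by simp)⟩
          rw [pt_append_right, sum_vrun]
          simp [pt]

/-- The upper exit condition holds as soon as the final height is strictly larger than all previous
ones. -/
lemma upperExit_of_pt {ℓs : List ℤ} (hne : weSteps ℓs ≠ [])
    (h : ∀ m < (weSteps ℓs).length, (pt (weSteps ℓs) m).2 < (weSteps ℓs).sum.2) :
    upperExit ℓs := by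
  intro i hi
  obtain ⟨m, h1, h2⟩ := exists_pt_weSteps ℓs hi
  rw [← h1, ← sum_weSteps_snd]
  apply h
  have := List.length_pos_iff.2 hne
  omega

lemma map_swap_vrun (ℓ : ℤ) : (vrun ℓ).map (fun p => (p.2, p.1)) = hrun ℓ := by
  unfold vrun hrun
  split_ifs <;> simp

lemma map_swap_weSteps (ℓs : List ℤ) : (weSteps ℓs).map (fun p => (p.2, p.1)) = snSteps ℓs := by
  induction ℓs with
  | nil => simp [weSteps, snSteps]
  | cons ℓ ℓs ih =>
    cases ℓs with
    | nil => simp [weSteps, snSteps, map_swap_vrun]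
    | cons ℓ' ℓs =>
      rw [weSteps_cons_cons, List.map_append, List.map_cons, ih, map_swap_vrun]
      simp [snSteps]

lemma map_swap_blockSteps (b : Bool) (ℓs : List ℤ) :
    (blockSteps b ℓs).map (fun p => (p.2, p.1)) = blockSteps (!b) ℓs := by
  cases b with
  | true => exact map_swap_weSteps ℓs
  | false =>
    change (snSteps ℓs).map _ = weSteps ℓs
    rw [← map_swap_weSteps, List.map_map]
    exact List.map_id _

lemma map_swap_neSteps (b : Bool) (bs : List (List ℤ)) :
    (neSteps b bs).map (fun p => (p.2, p.1)) = neSteps (!b) bs := by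
  induction bs generalizing b with
  | nil => simp [neSteps]
  | cons ℓs bs ih => simp [neSteps, map_swap_blockSteps, ih]

/-! ## Corners and blocks -/

/-- The coordinate systems obtained by permuting and reflecting the axes. -/
inductive Frame (x y : ℕ → ℤ) : (ℕ → ℤ) → (ℕ → ℤ) → Prop
  | refl : Frame x y x y
  | swap {x' y'} : Frame x y x' y' → Frame x y y' x'
  | neg {x' y'} : Frame x y x' y' → Frame x y (fun i => -x' i) y'

lemma Frame.prudent {x y x' y' : ℕ → ℤ} {L : ℕ} (hf : Frame x y x' y') (h : PrudentSeq x y L) :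
    PrudentSeq x' y' L := by
  induction hf with
  | refl => exact h
  | swap _ ih => exact ih.swap
  | neg _ ih => exact ih.neg

lemma Frame.segDecomp {x y x' y' : ℕ → ℤ} {s t N E : ℕ} {δ : ℤ} (hf : Frame x y x' y')
    (h : SegDecomp x' y' s t N E δ) : SegDecomp x y s t N E δ := by
  induction hf with
  | refl => exact h
  | swap _ ih => exact ih h.swap
  | neg _ ih => exact ih (by simpa using h.neg)

lemma Frame.trans {x y x' y' x'' y'' : ℕ → ℤ} (hf : Frame x y x' y') (hf' : Frame x' y' x'' y'') :
    Frame x y x'' y'' := by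
  induction hf' with
  | refl => exact hf
  | swap _ ih => exact ih.swap
  | neg _ ih => exact ih.neg

/-- At time `s` the path sits at the upper right corner of its past, on a new row, and goes west.
The index `k` bounds from below the dimensions of the past. -/
structure Corner (x y : ℕ → ℤ) (L s k : ℕ) : Prop where
  lt : s < L
  top : ∀ j < s, y j < y s
  right : ∀ j ≤ s, x j ≤ x s
  west : x (s + 1) = x s - 1
  width : ∃ j ≤ s, x j + (k / 2 : ℕ) ≤ x s
  height : ∃ j ≤ s, y j + ((k + 1) / 2 : ℕ) ≤ y s

/-- The path reaches, in some frame, a corner of index at least `k` at time `s`. -/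
def Reaches (x y : ℕ → ℤ) (L k s : ℕ) : Prop :=
  ∃ x' y' k', Frame x y x' y' ∧ Corner x' y' L s k' ∧ k ≤ k'

/-- A block which is not followed by a block of the same orientation. -/
def LastOrSwitch (x y : ℕ → ℤ) (L s t k : ℕ) : Prop :=
  s < t ∧ t ≤ L ∧ Rising y s t ∧
    (t = L ∨ (Corner y (fun i => -x i) L t (k + 1) ∧ k / 2 + 1 ≤ t - s))

/-- A block which is followed by a block of the same orientation. -/
def Regular (x y : ℕ → ℤ) (L s t k : ℕ) : Prop :=
  s < t ∧ Rising y s t ∧ Corner y x L t (k + 1)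

section

variable {x y : ℕ → ℤ} {L s t k : ℕ}

lemma PrudentSeq.sub_le (h : PrudentSeq x y L) (hst : s ≤ t) (ht : t ≤ L) : x s - x t ≤ t - s := by
  induction t, hst using Nat.le_induction with
  | base => simp
  | succ t hst ih =>
    have := ih (by omega)
    have := h.step t (by omega)
    push_cast
    omega

/-- A corner starts a block. -/
lemma Corner.exists_block (h : PrudentSeq x y L) (hc : Corner x y L s k) :
    ∃ t, LastOrSwitch x y L s t k ∨ Regular x y L s t k := by
  classical
  have hex : ∃ t, s ≤ t ∧ (t = L ∨ y (t + 1) = y t - 1) := ⟨L, hc.lt.le, Or.inl rfl⟩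
  obtain ⟨t, ⟨hst, ht⟩, hmin⟩ : ∃ t, (s ≤ t ∧ (t = L ∨ y (t + 1) = y t - 1)) ∧
      ∀ m < t, ¬(s ≤ m ∧ (m = L ∨ y (m + 1) = y m - 1)) :=
    ⟨Nat.find hex, Nat.find_spec hex, fun _ => Nat.find_min hex⟩
  have htL : t ≤ L := by
    by_contra hcon
    exact hmin L (by omega) ⟨hc.lt.le, Or.inl rfl⟩
  have hlt : s < t := by
    have := h.step s hc.lt
    have := hc.west
    have := hc.lt
    rcases hst.eq_or_lt with rfl | h1
    · omega
    · exact h1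
  have hr : Rising y s t := by
    intro i h1 h2
    have := h.step i (by omega)
    have := hmin i h2
    omega
  have hmax := hr.max (fun j hj => (hc.top j hj).le) hst le_rfl
  refine ⟨t, ?_⟩
  rcases htL.eq_or_lt with e | htL'
  · exact Or.inl ⟨hlt, htL, hr, Or.inl e⟩
  have hsouth : y (t + 1) = y t - 1 := by omega
  obtain ⟨j₁, hj₁, hw⟩ := hc.width
  obtain ⟨j₂, hj₂, hh⟩ := hc.height
  have hy := hmax s hst
  rcases h.strict_of_south htL' hmax hsouth with hx | hx
  · have := hx s hlt
    exact Or.inr ⟨hlt, hr, htL', hx, hmax, hsouth, ⟨j₂, by omega, by omega⟩, ⟨j₁, by omega, by omega⟩⟩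
  · have h1 := hx j₁ (by omega)
    have h2 := h.sub_le hst htL
    refine Or.inl ⟨hlt, htL, hr, Or.inr ⟨⟨htL', ?_, hmax, hsouth, ⟨j₂, by omega, by omega⟩,
      ⟨s, hst, ?_⟩⟩, ?_⟩⟩
    · intro j hj
      have := hx j hj
      omega
    · omega
    · omega

/-- Cutting a block into lines and a partially directed piece. -/
lemma Corner.segDecomp (h : PrudentSeq x y L) (hc : Corner x y L s k) (hst : s < t) (ht : t ≤ L)
    (hr : Rising y s t) {c : ℕ} (hc1 : 1 ≤ c) :
    ∃ N, SegDecomp x y s t N (4 * c) 0 ∧ c * N ≤ 2 * (t - s) + 3 * c := by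
  obtain ⟨k, hk, hrow, hup⟩ := exists_row h hst.le ht hr
  have hk0 : 0 < k := by
    rcases Nat.eq_zero_or_pos k with rfl | h0
    · have := hup hst
      have := hc.west
      rw [add_zero] at *
      omega
    · exact h0
  have hs : ∀ j < s, y j ≤ y s := fun j hj => (hc.top j hj).le
  have hline := segDecomp_line (t := s + k) h (by omega) (by omega) hs
    (hr.mono le_rfl (by omega)) fun i h1 h2 => by
      have := hrow i h1 h2
      have := hrow s le_rfl (by omega)
      omega
  rcases hk.eq_or_lt with hkt | hkt
  · subst hkt
    exact ⟨1, hline.mono le_rfl (by omega) (by omega), by omega⟩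
  · have hstep := segDecomp_line (s := s + k) (t := s + k + 1) h (by omega) (by omega)
      (fun j hj => hr.max hs (by omega) (by omega) j hj.le)
      (hr.mono (by omega) (by omega)) fun i h1 h2 => by
        obtain rfl : i = s + k := by omega
        exact ⟨rfl, rfl⟩
    obtain ⟨N, h1, h2⟩ := segDecomp_of_rising h ht hc1 (s := s + k + 1) (by omega)
      (hr.mono (by omega) le_rfl) fun j hj => by
        have := hr.max hs (i := s + k) (by omega) (by omega) j (by omega)
        have := hup hkt
        omega
    refine ⟨1 + 1 + N, ((hline.append hstep (by omega) (by omega)).append h1 (by omega)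
      (by omega)).mono le_rfl (by omega) (by omega), ?_⟩
    rw [mul_add, mul_add]
    omega

lemma sum_seg (x y : ℕ → ℤ) (hst : s ≤ t) : (seg x y s t).sum = (x t - x s, y t - y s) := by
  have := pt_seg x y s t (t - s) le_rfl
  rw [← length_seg x y s t, pt_length, length_seg, Nat.add_sub_cancel' hst] at this
  exact this

/-- A block followed by a block of the same orientation is an oriented block. -/
lemma Corner.exists_stretches (h : PrudentSeq x y L) (hc : Corner x y L s k)
    (hreg : Regular x y L s t k) :
    ∃ ℓs, (ℓs ≠ [] ∧ ℓs.headI < 0 ∧ upperExit ℓs) ∧ weSteps ℓs = seg y x s t := by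
  obtain ⟨hst, hr, hc'⟩ := hreg
  obtain ⟨ℓ, ℓs, h1, h2, -⟩ := (pdWord_of_rising h hc'.lt.le hr).exists_stretches
  refine ⟨ℓ :: ℓs, ⟨by simp, ?_, ?_⟩, h1⟩
  · rw [List.headI_cons, h2, seg_cons _ _ hst]
    have := h.step s hc.lt
    have := hc.west
    simp only [List.head?_cons, Option.some.injEq, Prod.mk.injEq]
    omega
  · apply upperExit_of_pt
    · rw [h1, ← List.length_pos_iff, length_seg]
      omega
    · intro m hm
      rw [h1, length_seg] at hm
      rw [h1, pt_seg _ _ _ _ _ hm.le, sum_seg _ _ hst.le]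
      have := hc'.top (s + m) (by omega)
      simp only
      omega

/-- A maximal run of blocks of the same orientation, followed by a last or switching block. -/
lemma Corner.exists_run (h : PrudentSeq x y L) (hc : Corner x y L s k) :
    ∃ u bs, s ≤ u ∧ Genuine bs ∧ neSteps true bs = seg y x s u ∧
      (∀ i, s ≤ i → i < u → (y s ≤ y i ∧ y s ≤ y (i + 1)) ∨
        (x s + 1 ≤ x i ∧ x s + 1 ≤ x (i + 1))) ∧
      ∃ x' y' k' t, Frame x y x' y' ∧ k ≤ k' ∧ Corner x' y' L u k' ∧
        LastOrSwitch x' y' L u t k' := by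
  induction hn : L - s using Nat.strong_induction_on generalizing x y s k with
  | _ n ih =>
    obtain ⟨t, ht | ht⟩ := hc.exists_block h
    · exact ⟨s, [], le_rfl, by simp [Genuine], by simp [neSteps, seg_self], fun i h1 h2 => by omega,
        x, y, k, t, .refl, le_rfl, hc, ht⟩
    · obtain ⟨ℓs, h1, h2⟩ := hc.exists_stretches h ht
      obtain ⟨hst, hr, hc'⟩ := ht
      obtain ⟨u, bs, h3, h4, h5, h6, x', y', k', t', h7, h8, h9⟩ :=
        ih (L - t) (by have := hc'.lt; omega) h.swap hc' rfl
      refine ⟨u, ℓs :: bs, by omega, ?_, ?_, ?_, x', y', k', t', (Frame.refl.swap).trans h7,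
        by omega, h9⟩
      · intro ℓs' hm
        rcases List.mem_cons.1 hm with rfl | hm
        exacts [h1, h4 _ hm]
      · have : neSteps (!true) bs = seg y x t u := by
          rw [← map_swap_neSteps, h5]
          simp [seg]
        rw [neSteps, this, ← seg_append y x hst.le h3, ← h2]
        rfl
      · intro i hi hiu
        rcases lt_or_ge i t with hit | hit
        · exact Or.inl ⟨hr.le le_rfl hi hit.le, hr.le le_rfl (by omega) (by omega)⟩
        · have := h6 i hit hiu
          have := hc'.top s hst
          have := hc'.right s hst.le
          omega

end

/-! ## Decomposition of prudent paths -/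

section

variable {x y : ℕ → ℤ} {L s t k : ℕ}

lemma pastEnergy_swap (x y : ℕ → ℤ) (s t : ℕ) : pastEnergy y x s t = pastEnergy x y s t := by
  have : ∀ i j, Touch y x i j ↔ Touch x y i j := by
    intro i j
    unfold Touch
    rw [add_comm]
  simp only [pastEnergy, touchCount, this]

/-- A run of blocks of the same orientation touches the past only during its first two blocks. -/
lemma Corner.pastEnergy_run_le (h : PrudentSeq x y L) (hc : Corner x y L s k) {t₁ t₂ u : ℕ}
    (h₁ : Regular x y L s t₁ k) (h₂ : Regular y x L t₁ t₂ (k + 1)) (hu : t₂ ≤ u)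
    (hfar : ∀ i, t₂ ≤ i → i < u → (y t₂ ≤ y i ∧ y t₂ ≤ y (i + 1)) ∨
        (x t₂ + 1 ≤ x i ∧ x t₂ + 1 ≤ x (i + 1))) :
    pastEnergy x y s u ≤ 2 * (t₁ - s) + 2 + (2 * (t₂ - t₁) + 2) := by
  obtain ⟨hst, hr, hc₁⟩ := h₁
  obtain ⟨htt, hr', hc₂⟩ := h₂
  have p1 : pastEnergy x y s t₁ ≤ 2 * (t₁ - s) + 2 :=
    pastEnergy_le_of_rising h hc₁.lt.le hr hc.top fun h1 => by omega
  have p2 : pastEnergy y x t₁ t₂ ≤ 2 * (t₂ - t₁) + 2 :=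
    pastEnergy_le_of_rising h.swap hc₂.lt.le hr' hc₁.top fun h1 => by omega
  rw [pastEnergy_swap] at p2
  have p3 : ∑ j ∈ Finset.Ico t₁ t₂, touchCount x y 0 s j ≤ pastEnergy x y t₁ t₂ := by
    refine Finset.sum_le_sum fun j _ => ?_
    rw [touchCount_split x y j (Nat.zero_le s) hst.le]
    omega
  have p4 : ∑ j ∈ Finset.Ico t₂ u, touchCount x y 0 s j = 0 := by
    refine Finset.sum_eq_zero fun j hj => ?_
    rw [Finset.mem_Ico] at hj
    rw [touchCount, Finset.card_eq_zero, Finset.filter_eq_empty_iff]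
    intro i hi hT
    rw [Finset.mem_Ico] at hi
    unfold Touch at hT
    have a1 := hc.top i hi.2
    have a2 : y (i + 1) ≤ y s := by
      rcases (show i + 1 ≤ s by omega).eq_or_lt with e | e
      · rw [e]
      · exact (hc.top _ e).le
    have a3 := hc.right i hi.2.le
    have a4 := hc.right (i + 1) hi.2
    have b1 := hc₂.top t₁ htt
    have b2 := hc₂.right t₁ htt.le
    have b3 := hc₁.top s hst
    have b4 := hc₁.right s hst.le
    rcases hfar j hj.1 hj.2 with f | f
    · have : y i + y (i + 1) - (y j + y (j + 1)) ≤ -3 := by omega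
      nlinarith [sq_nonneg (x i + x (i + 1) - (x j + x (j + 1)))]
    · have : x i + x (i + 1) - (x j + x (j + 1)) ≤ -3 := by omega
      nlinarith [sq_nonneg (y i + y (i + 1) - (y j + y (j + 1)))]
  have e1 : pastEnergy x y s u = pastEnergy x y s t₁ +
      ∑ j ∈ Finset.Ico t₁ t₂, touchCount x y 0 s j +
      ∑ j ∈ Finset.Ico t₂ u, touchCount x y 0 s j := by
    unfold pastEnergy
    rw [Finset.sum_Ico_consecutive _ hst.le htt.le,
      Finset.sum_Ico_consecutive _ (by omega) hu]
  omega

lemma LastOrSwitch.reaches {u : ℕ} {x' y' : ℕ → ℤ} {k' : ℕ} (hf : Frame x y x' y') (hk : k ≤ k')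
    (hsu : s ≤ u) (h : LastOrSwitch x' y' L u t k') :
    t = L ∨ (k / 2 + 1 ≤ t - s ∧ Reaches x y L (k + 1) t) := by
  obtain ⟨h1, -, -, h2 | ⟨h2, h3⟩⟩ := h
  · exact Or.inl h2
  · exact Or.inr ⟨by omega, _, _, _, (hf.neg).swap, h2, by omega⟩

/-- From one corner to a later one. Either a long stretch of the path is decomposed at a small
cost, or the index of the corner increases. -/
lemma Corner.exists_step (h : PrudentSeq x y L) (hc : Corner x y L s k) (b : ℕ) {c : ℕ}
    (hc1 : 1 ≤ c) :
    ∃ s' N E, s < s' ∧ s' ≤ L ∧ SegDecomp x y s s' N E 0 ∧ c * N ≤ 2 * (s' - s) + 7 * c ∧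
      ((b ≤ s' - s ∧ E ≤ 8 * c ∧ Reaches x y L k s') ∨
       (E ≤ 8 * c + 4 * b ∧
          (s' = L ∨ (k / 2 + 1 ≤ s' - s ∧ Reaches x y L (k + 1) s')))) := by
  obtain ⟨t₁, h₁ | h₁⟩ := hc.exists_block h
  · obtain ⟨N, d1, d2⟩ := hc.segDecomp h h₁.1 h₁.2.1 h₁.2.2.1 hc1
    exact ⟨t₁, N, 4 * c, h₁.1, h₁.2.1, d1, by omega, Or.inr ⟨by omega,
      h₁.reaches .refl le_rfl le_rfl⟩⟩
  obtain ⟨hst, hr, hc₁⟩ := id h₁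
  have ht₁ := hc₁.lt
  obtain ⟨N, d1, d2⟩ := hc.segDecomp h hst hc₁.lt.le hr hc1
  rcases le_or_gt b (t₁ - s) with hb | hb
  · exact ⟨t₁, N, 4 * c, hst, hc₁.lt.le, d1, by omega,
      Or.inl ⟨hb, by omega, _, _, _, Frame.refl.swap, hc₁, by omega⟩⟩
  obtain ⟨t₂, h₂ | h₂⟩ := hc₁.exists_block h.swap
  · obtain ⟨N', d1', d2'⟩ := hc₁.segDecomp h.swap h₂.1 h₂.2.1 h₂.2.2.1 hc1
    have := h₂.1
    refine ⟨t₂, N + N', 4 * c + 4 * c, by omega, h₂.2.1,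
      (d1.append d1'.swap hst.le h₂.1.le).mono le_rfl le_rfl (by simp), ?_, Or.inr ⟨by omega,
      h₂.reaches Frame.refl.swap (by omega) hst.le⟩⟩
    rw [mul_add]
    omega
  obtain ⟨htt, hr', hc₂⟩ := id h₂
  have ht₂ := hc₂.lt
  rcases le_or_gt b (t₂ - t₁) with hb' | hb'
  · obtain ⟨N', d1', d2'⟩ := hc₁.segDecomp h.swap htt hc₂.lt.le hr' hc1
    refine ⟨t₂, N + N', 4 * c + 4 * c, by omega, hc₂.lt.le,
      (d1.append d1'.swap hst.le htt.le).mono le_rfl le_rfl (by simp), ?_,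
      Or.inl ⟨by omega, by omega, _, _, _, .refl, hc₂, by omega⟩⟩
    rw [mul_add]
    omega
  obtain ⟨u, bs, hu, hbs, hseg, hfar, x', y', k', t, hf, hk', hcu, hlast⟩ := hc₂.exists_run h
  have hlast' := hlast
  obtain ⟨hut, htL, hru, -⟩ := hlast'
  obtain ⟨ℓs₁, g₁, e₁⟩ := hc.exists_stretches h h₁
  obtain ⟨ℓs₂, g₂, e₂⟩ := hc₁.exists_stretches h.swap h₂
  have hpast := hc.pastEnergy_run_le h h₁ h₂ hu hfar
  have hne : SegDecomp x y s u 1 (4 * b) 0 := by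
    refine Decomp.ne (LatticeSym.swap LatticeSym.id) (g := fun p => (p.2, p.1))
      (bs := ℓs₁ :: ℓs₂ :: bs) ?_ ?_ ?_
    · intro ℓs hm
      simp only [List.mem_cons] at hm
      rcases hm with rfl | rfl | hm
      exacts [g₁, g₂, hbs _ hm]
    · have e3 : snSteps ℓs₂ = seg y x t₁ t₂ := by
        rw [← map_swap_weSteps, e₂]
        simp [seg]
      have e4 : (seg x y s u).map (fun p => (p.2, p.1)) = seg y x s u := by simp [seg]
      rw [e4, ← seg_append y x (hst.le.trans htt.le) hu, ← seg_append y x hst.le htt.le, ← hseg, ← e3,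
        ← e₁]
      simp [neSteps, blockSteps]
    · rw [addedEnergy_eq]
      omega
  obtain ⟨N', d1', d2'⟩ := hcu.segDecomp (hf.prudent h) hut htL hru hc1
  refine ⟨t, 1 + N', 4 * b + 4 * c, by omega, htL,
      (hne.append (hf.segDecomp d1') (by omega) hut.le).mono le_rfl le_rfl (by simp), ?_,
      Or.inr ⟨by omega, hlast.reaches hf (by omega) (by omega)⟩⟩
  rw [mul_add]
  omega

/-- Decomposition of the path from a corner on. -/
lemma Corner.exists_decomp (h : PrudentSeq x y L) (hc : Corner x y L s k) (b q : ℕ) {c : ℕ}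
    (hc1 : 1 ≤ c) :
    ∃ nd ns N E, SegDecomp x y s L N E 0 ∧ nd * b ≤ L - s ∧
      ns * q ≤ (L - s) + q * (2 * q - k) + q ∧ c * N ≤ 2 * (L - s) + 7 * c * (nd + ns) ∧
      E ≤ 8 * c * (nd + ns) + 4 * b * ns := by
  induction hn : L - s using Nat.strong_induction_on generalizing x y s k with
  | _ n ih =>
    subst hn
    obtain ⟨s', N, E, h1, h2, h3, h4, h5⟩ := hc.exists_step h b hc1
    rcases h5 with ⟨h5, h6, x', y', k', hf, hc', hk'⟩ | ⟨h6, rfl | ⟨h5, x', y', k', hf, hc', hk'⟩⟩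
    · obtain ⟨nd, ns, N', E', i1, i2, i3, i4, i5⟩ :=
        ih (L - s') (by omega) (hf.prudent h) hc' rfl
      refine ⟨nd + 1, ns, N + N', E + E', ?_, ?_, ?_, ?_, ?_⟩
      · exact (h3.append (hf.segDecomp i1) h1.le h2).mono le_rfl le_rfl (by simp)
      · rw [add_mul]; omega
      · have : q * (2 * q - k') ≤ q * (2 * q - k) := Nat.mul_le_mul_left _ (by omega)
        omega
      · have : L - s = L - s' + (s' - s) := by omega
        rw [this]
        nlinarith
      · nlinarith
    · refine ⟨0, 1, N, E, h3, by simp, by omega, by omega, by omega⟩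
    · obtain ⟨nd, ns, N', E', i1, i2, i3, i4, i5⟩ :=
        ih (L - s') (by omega) (hf.prudent h) hc' rfl
      refine ⟨nd, ns + 1, N + N', E + E', ?_, ?_, ?_, ?_, ?_⟩
      · exact (h3.append (hf.segDecomp i1) h1.le h2).mono le_rfl le_rfl (by simp)
      · omega
      · rw [add_mul]
        rcases lt_or_ge k (2 * q) with hk | hk
        · have : q * (2 * q - k' + 1) ≤ q * (2 * q - k) := Nat.mul_le_mul_left _ (by omega)
          rw [mul_add] at this
          omega
        · have : q * (2 * q - k') ≤ q * (2 * q - k) := Nat.mul_le_mul_left _ (by omega)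
          omega
      · have : L - s = L - s' + (s' - s) := by omega
        rw [this]
        nlinarith
      · nlinarith

/-- Decomposition of a prudent path. -/
lemma PrudentSeq.exists_decomp (h : PrudentSeq x y L) (b q : ℕ) {c : ℕ} (hc1 : 1 ≤ c) :
    ∃ nd ns N E, SegDecomp x y 0 L N E 0 ∧ nd * b ≤ L ∧
      ns * q ≤ L + 2 * q * q + q ∧ c * N ≤ 2 * L + 7 * c * (nd + ns) ∧
      E ≤ 8 * c * (nd + ns) + 4 * b * ns := by
  rcases Nat.eq_zero_or_pos L with rfl | hL
  · exact ⟨0, 0, 0, 0, SegDecomp.refl x y 0, by simp⟩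
  have key : ∀ x' y', Frame x y x' y' → x' 1 = x' 0 - 1 → Corner x' y' L 0 0 := by
    intro x' y' hf hw
    exact ⟨hL, by simp, by simp, hw, ⟨0, by simp⟩, ⟨0, by simp⟩⟩
  obtain ⟨x', y', hf, hw⟩ : ∃ x' y', Frame x y x' y' ∧ x' 1 = x' 0 - 1 := by
    have := h.step 0 hL
    rw [zero_add] at this
    rcases this with h1 | h1 | h1 | h1
    · exact ⟨_, _, Frame.refl.neg, by omega⟩
    · exact ⟨_, _, Frame.refl, by omega⟩
    · exact ⟨_, _, Frame.refl.swap.neg, by omega⟩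
    · exact ⟨_, _, Frame.refl.swap, by omega⟩
  obtain ⟨nd, ns, N, E, h1, h2, h3, h4, h5⟩ :=
    (key x' y' hf hw).exists_decomp (hf.prudent h) b q hc1
  refine ⟨nd, ns, N, E, hf.segDecomp h1, by omega, ?_, by omega, h5⟩
  have : 2 * q * q = q * (2 * q - 0) := by rw [Nat.sub_zero]; ring
  omega

end

/-! ## Zigzags -/

lemma PDWord.append_east {u v : List (ℤ × ℤ)} (hu : PDWord u) (hv : PDWord v) :
    PDWord (u ++ (1, 0) :: v) := by
  constructor
  · intro d hd
    simp only [List.mem_append, List.mem_cons] at hd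
    rcases hd with hd | rfl | hd
    exacts [hu.1 d hd, Or.inl rfl, hv.1 d hd]
  · rw [List.isChain_append, List.isChain_cons]
    refine ⟨hu.2, ⟨fun d hd => ?_, hv.2⟩, fun d hd e he => ?_⟩
    · rcases hv.1 d (List.mem_of_mem_head? hd) with rfl | rfl | rfl <;> simp
    · obtain rfl : e = (1, 0) := by simpa using he.symm
      rcases hu.1 d (List.mem_of_mem_getLast? hd) with rfl | rfl | rfl <;> simp

lemma pdWord_nil : PDWord [] := ⟨by simp, by simp⟩

lemma pdWord_replicate (n : ℕ) {d : ℤ × ℤ} (hd : d = (1, 0) ∨ d = (0, 1) ∨ d = (0, -1)) :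
    PDWord (List.replicate n d) := by
  refine ⟨fun e he => by rw [List.eq_of_mem_replicate he]; exact hd, ?_⟩
  apply List.isChain_replicate_of_rel
  rcases hd with rfl | rfl | rfl <;> simp

lemma PDWord.append_flatten {u : List (ℤ × ℤ)} (hu : PDWord u) (P : List (List (ℤ × ℤ)))
    (hP : ∀ p ∈ P, PDWord p) : PDWord (u ++ (P.map fun p => (1, 0) :: p).flatten) := by
  induction P generalizing u with
  | nil => simpa using hu
  | cons p P ih =>
    have := ih (hu.append_east (hP p List.mem_cons_self)) fun p hp => hP p (List.mem_cons_of_mem _ hp)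
    simpa using this

/-- A zigzag of `k` vertical stretches of length `h`, the first one going in the direction `σ`. -/
def zigzag (h : ℕ) : ℕ → ℤ → List (ℤ × ℤ)
  | 0, _ => []
  | k + 1, σ => List.replicate h (0, σ) ++ (1, 0) :: zigzag h k (-σ)

lemma length_zigzag (h k : ℕ) (σ : ℤ) : (zigzag h k σ).length = k * (h + 1) := by
  induction k generalizing σ with
  | zero => simp [zigzag]
  | succ k ih => simp [zigzag, ih]; ring

lemma pdWord_zigzag (h k : ℕ) {σ : ℤ} (hσ : σ = 1 ∨ σ = -1) : PDWord (zigzag h k σ) := by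
  induction k generalizing σ with
  | zero => exact pdWord_nil
  | succ k ih =>
    refine PDWord.append_east (pdWord_replicate h ?_) (ih (by omega))
    rcases hσ with rfl | rfl <;> simp

lemma pt_replicate (d : ℤ × ℤ) {n i : ℕ} (hi : i ≤ n) : pt (List.replicate n d) i = i • d := by
  simp [pt, hi]

lemma le_ham_replicate (n : ℕ) {σ : ℤ} (hσ : σ = 1 ∨ σ = -1) :
    n ≤ Ham (List.replicate n (0, σ)) + 1 := by
  have e : seg (fun _ => 0) (fun i => σ * i) 0 n = List.replicate n (0, σ) := by
    rw [List.eq_replicate_iff]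
    refine ⟨by simp, fun d hd => ?_⟩
    obtain ⟨i, -, -, rfl⟩ := mem_seg hd
    simp only [Prod.mk.injEq, sub_self, true_and]
    push_cast; ring
  rw [← e, ham_seg]
  cases n with
  | zero => simp
  | succ n =>
    rw [← Finset.range_eq_Ico, Finset.sum_range_succ']
    have : ∑ j ∈ Finset.range n, 1 ≤ ∑ j ∈ Finset.range n,
        touchCount (fun _ => 0) (fun i => σ * i) 0 (j + 1) (j + 1) := by
      refine Finset.sum_le_sum fun j _ => ?_
      rw [touchCount, Nat.one_le_iff_ne_zero, Finset.card_ne_zero]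
      refine ⟨j, ?_⟩
      refine Finset.mem_filter.2 ⟨Finset.mem_Ico.2 (by omega), ?_⟩
      unfold Touch
      rcases hσ with rfl | rfl <;> push_cast <;> ring
    simp only [Finset.sum_const, Finset.card_range, smul_eq_mul, mul_one] at this
    omega

/-- Two consecutive stretches of a zigzag touch along their whole length. -/
lemma ham_two_stretches (h : ℕ) (σ : ℤ) (R : List (ℤ × ℤ)) :
    Ham (List.replicate h (0, σ)) + Ham (List.replicate h (0, -σ) ++ R) + h ≤
      Ham (List.replicate h (0, σ) ++ (1, 0) :: (List.replicate h (0, -σ) ++ R)) := by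
  obtain ⟨u, hu⟩ : ∃ u : List (ℤ × ℤ), u = List.replicate h (0, σ) ++ [(1, 0)] := ⟨_, rfl⟩
  obtain ⟨v, hv⟩ : ∃ v : List (ℤ × ℤ), v = List.replicate h (0, -σ) ++ R := ⟨_, rfl⟩
  have e : List.replicate h (0, σ) ++ (1, 0) :: v = u ++ v := by simp [hu]
  have hlu : u.length = h + 1 := by simp [hu]
  have hlv : h ≤ v.length := by simp [hv]
  have hsum : u.sum = (1, σ * h) := by simp [hu, mul_comm]
  rw [← hv, e, ham_append u v]
  have h1 := ham_append_ge (List.replicate h (0, σ)) [(1, 0)]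
  rw [← hu] at h1
  have p1 : ∀ i ≤ h, pt (u ++ v) i = (0, σ * i) := by
    intro i hi
    rw [pt_append_left _ _ (by omega), hu, pt_append_left _ _ (by simpa using hi), pt_replicate _ hi]
    simp [mul_comm]
  have p2 : ∀ m ≤ h, pt (u ++ v) (h + 1 + m) = (1, σ * (h - m)) := by
    intro m hm
    rw [← hlu, pt_append_right, hsum, hv, pt_append_left _ _ (by simpa using hm), pt_replicate _ hm]
    simp
    ring
  have h2 : ∑ j ∈ Finset.Ico (h + 1) (h + 1 + h), 1 ≤
      ∑ j ∈ Finset.Ico u.length (u ++ v).length,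
        touchCount (fun i => (pt (u ++ v) i).1) (fun i => (pt (u ++ v) i).2) 0 u.length j := by
    rw [List.length_append, hlu]
    refine (Finset.sum_le_sum fun j hj => ?_).trans (Finset.sum_le_sum_of_subset
      (Finset.Ico_subset_Ico le_rfl (by omega)))
    rw [Finset.mem_Ico] at hj
    obtain ⟨m, rfl⟩ : ∃ m, j = h + 1 + m := ⟨j - (h + 1), by omega⟩
    rw [touchCount, Nat.one_le_iff_ne_zero, Finset.card_ne_zero]
    refine ⟨h - 1 - m, ?_⟩
    refine Finset.mem_filter.2 ⟨Finset.mem_Ico.2 (by omega), ?_⟩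
    simp only [Touch]
    rw [p1 _ (by omega), p1 _ (by omega), p2 _ (by omega), add_assoc, p2 _ (by omega)]
    have : ((h - 1 - m : ℕ) : ℤ) = h - 1 - m := by omega
    push_cast [this]
    ring
  simp only [Finset.sum_const, Nat.card_Ico, smul_eq_mul, mul_one] at h2
  omega

lemma le_ham_zigzag (h k : ℕ) {σ : ℤ} (hσ : σ = 1 ∨ σ = -1) :
    2 * h * k ≤ Ham (zigzag h k σ) + h + k := by
  induction k generalizing σ with
  | zero => simp
  | succ k ih =>
    have h1 := le_ham_replicate h hσ
    cases k with
    | zero =>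
      have := ham_append_ge (List.replicate h (0, σ)) [(1, 0)]
      simp only [zigzag]
      omega
    | succ k =>
      have h2 := ih (σ := -σ) (by omega)
      have h3 := ham_two_stretches h σ ((1, 0) :: zigzag h k (- -σ))
      simp only [zigzag] at h2 h3 ⊢
      nlinarith

/-- A partially directed word of given length starting with a south step, with nearly maximal
energy. -/
lemma exists_dense (h T : ℕ) (hT : 1 ≤ T) :
    ∃ z, PDWord z ∧ z.head? = some (0, -1) ∧ z.length = T ∧
      2 * T ≤ Ham z + 3 * (T / (h + 1)) + 3 * h + 2 := by
  set k := (T - 1) / (h + 1) with hk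
  set r := (T - 1) % (h + 1) with hr
  have hdiv : k * (h + 1) + r = T - 1 := Nat.div_add_mod' _ _
  have hrlt : r < h + 1 := Nat.mod_lt _ (by omega)
  have hkT : k ≤ T / (h + 1) := Nat.div_le_div_right (by omega)
  have hpd : PDWord ((0, -1) :: zigzag h k (-1)) := by
    cases k with
    | zero => exact pdWord_replicate 1 (by simp)
    | succ k =>
      exact PDWord.append_east (pdWord_replicate (h + 1) (by simp)) (pdWord_zigzag h k (by simp))
  refine ⟨((0, -1) :: zigzag h k (-1)) ++ List.replicate r (1, 0), ?_, by simp, ?_, ?_⟩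
  · cases r with
    | zero => simpa using hpd
    | succ r => exact hpd.append_east (pdWord_replicate r (by simp))
  · simp [length_zigzag]
    omega
  · have h1 := le_ham_zigzag h k (σ := -1) (by simp)
    have h2 := ham_append_ge ((0, -1) :: zigzag h k (-1)) (List.replicate r (1, 0))
    have h3 := ham_append_ge [(0, -1)] (zigzag h k (-1))
    rw [List.singleton_append] at h3
    have : T = k * (h + 1) + r + 1 := by omega
    nlinarith

/-! ## Prudence of concatenations of oriented blocks -/

/-- All letters are unit steps. -/
def DirWord (l : List (ℤ × ℤ)) : Prop := ∀ d ∈ l, ∃ k, d = dirs k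

lemma PDWord.dirWord {l : List (ℤ × ℤ)} (h : PDWord l) : DirWord l := by
  intro d hd
  rcases h.1 d hd with rfl | rfl | rfl
  exacts [⟨0, rfl⟩, ⟨2, rfl⟩, ⟨3, rfl⟩]

lemma DirWord.step {l : List (ℤ × ℤ)} (h : DirWord l) {i : ℕ} (hi : i < l.length) :
    l[i] = (1, 0) ∨ l[i] = (-1, 0) ∨ l[i] = (0, 1) ∨ l[i] = (0, -1) := by
  obtain ⟨k, hk⟩ := h _ (List.getElem_mem hi)
  rw [hk]
  fin_cases k <;> simp [dirs]

lemma prudentSeq_of_isPrudent {l : List (ℤ × ℤ)} (hl : DirWord l) (h : IsPrudent l) :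
    PrudentSeq (fun i => (pt l i).1) (fun i => (pt l i).2) l.length := by
  have hs : ∀ i, (hi : i < l.length) → pt l (i + 1) = pt l i + l[i] := fun i hi => pt_succ l hi
  have key : ∀ i, (hi : i < l.length) → ∀ k : ℤ, 1 ≤ k → ∀ j ≤ i,
      pt l i + k • l[i] ≠ pt l j := by
    intro i hi k hk j hj
    have := h i hi k.toNat (by omega) j hj
    rwa [Int.toNat_of_nonneg (by omega), List.getD_eq_getElem _ _ hi] at this
  constructor
  · intro i hi
    have := hl.step hi
    simp only [hs i hi, Prod.fst_add, Prod.snd_add]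
    rcases this with e | e | e | e <;> rw [e] <;> simp [sub_eq_add_neg]
  all_goals
    intro i hi h1 j hj h2
    simp only [hs i hi, Prod.fst_add, Prod.snd_add] at h1 h2 ⊢
    by_contra hcon
    have k1 := key i hi
    rcases hl.step hi with e | e | e | e <;> rw [e] at h1 k1 <;> simp at h1 <;> try omega
  · exact k1 ((pt l j).1 - (pt l i).1) (by omega) j hj (by ext <;> simp [h2])
  · exact k1 ((pt l i).1 - (pt l j).1) (by omega) j hj (by ext <;> simp [h2])
  · exact k1 ((pt l j).2 - (pt l i).2) (by omega) j hj (by ext <;> simp [h2])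
  · exact k1 ((pt l i).2 - (pt l j).2) (by omega) j hj (by ext <;> simp [h2])

lemma isPrudent_of_prudentSeq {l : List (ℤ × ℤ)} (hl : DirWord l)
    (h : PrudentSeq (fun i => (pt l i).1) (fun i => (pt l i).2) l.length) : IsPrudent l := by
  intro i hi k hk j hj e
  have hs := pt_succ l hi
  rw [List.getD_eq_getElem _ _ hi] at e
  have he := h.east i hi
  have hw := h.west i hi
  have hn := h.north i hi
  have hso := h.south i hi
  simp only [hs] at he hw hn hso
  rcases hl.step hi with e' | e' | e' | e' <;> rw [e'] at e he hw hn hso <;>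
    rw [Prod.ext_iff] at e <;> simp at e
  · have := he (by simp) j hj (by omega); omega
  · have := hw (by simp [sub_eq_add_neg]) j hj (by omega); omega
  · have := hn (by simp) j hj (by omega); omega
  · have := hso (by simp [sub_eq_add_neg]) j hj (by omega); omega

/-- Extending a prudent path from a strictly new top row by a partially directed piece. -/
lemma PrudentSeq.extend {x y : ℕ → ℤ} {s t : ℕ} (h : PrudentSeq x y s) (hst : s ≤ t)
    (htop : ∀ j < s, y j < y s) (hpd : PDWord (seg y x s t)) : PrudentSeq x y t := by
  have hstep : ∀ i, s ≤ i → i < t → (x (i + 1) = x i + 1 ∧ y (i + 1) = y i) ∨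
      (x (i + 1) = x i - 1 ∧ y (i + 1) = y i) ∨ (x (i + 1) = x i ∧ y (i + 1) = y i + 1) := by
    intro i h1 h2
    have := hpd.1 (y (i + 1) - y i, x (i + 1) - x i)
      (List.mem_map.2 ⟨i, List.mem_range'_1.2 (by omega), rfl⟩)
    simp only [Prod.mk.injEq] at this
    omega
  have hchain : ∀ i, s ≤ i → i + 1 < t →
      ¬(x (i + 1 + 1) - x (i + 1) = -(x (i + 1) - x i) ∧ y (i + 1 + 1) - y (i + 1) = -(y (i + 1) - y i)) := by
    intro i h1 h2 h3
    have h4 := (List.isChain_iff_getElem.1 hpd.2) (i - s) (by rw [length_seg]; omega)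
    have e1 : s + (i - s) = i := by omega
    simp only [seg, List.getElem_map, List.getElem_range', one_mul, ne_eq, Prod.ext_iff,
      Prod.fst_add, Prod.snd_add, Prod.fst_zero, Prod.snd_zero, ← add_assoc, e1] at h4
    omega
  have hr : Rising y s t := by
    intro i h1 h2
    have := hstep i h1 h2
    omega
  have hrow : ∀ n j i, i = j + n → s ≤ j → i < t → y j = y i → y (i + 1) = y i →
      x (j + 1) - x j = x (i + 1) - x i ∧ y (j + 1) = y j ∧
        0 ≤ (x i - x j) * (x (i + 1) - x i) := by
    intro n
    induction n with
    | zero =>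
      rintro j i rfl h1 h2 h3 h4
      exact ⟨rfl, h4, by simp⟩
    | succ n ih =>
      intro j i e h1 h2 h3 h4
      have h5 := hr.le (i := j + 1) (j := i) (by omega) (by omega) (by omega)
      have h6 := hstep j h1 (by omega)
      obtain ⟨i1, i2, i3⟩ := ih (j + 1) i (by omega) (by omega) h2 (by omega) h4
      have h7 := hchain j h1 (by omega)
      have h8 := hstep i (by omega) h2
      refine ⟨by omega, by omega, ?_⟩
      rcases h8 with h8 | h8 | h8
      · rw [h8.1] at i3 i1 ⊢; simp at *; omega
      · rw [h8.1] at i3 i1 ⊢; simp at *; omega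
      · omega
  have htop' : ∀ j < s, ∀ i, s ≤ i → i < t → y j < y i := fun j hj i h1 h2 =>
    (htop j hj).trans_le (hr.le le_rfl h1 h2.le)
  constructor
  · intro i hi
    rcases lt_or_ge i s with h1 | h1
    · exact h.step i h1
    · have := hstep i h1 hi
      omega
  · intro i hi h1 j hj h2
    rcases lt_or_ge i s with h3 | h3
    · exact h.east i h3 h1 j hj h2
    · rcases lt_or_ge j s with h4 | h4
      · have := htop' j h4 i h3 hi; omega
      · have h5 := hstep i h3 hi
        have := hrow (i - j) j i (by omega) h4 hi h2 (by omega)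
        rw [h1] at this
        simp at this
        omega
  · intro i hi h1 j hj h2
    rcases lt_or_ge i s with h3 | h3
    · exact h.west i h3 h1 j hj h2
    · rcases lt_or_ge j s with h4 | h4
      · have := htop' j h4 i h3 hi; omega
      · have h5 := hstep i h3 hi
        have := hrow (i - j) j i (by omega) h4 hi h2 (by omega)
        rw [h1] at this
        simp at this
        omega
  · intro i hi h1 j hj h2
    rcases lt_or_ge i s with h3 | h3
    · exact h.north i h3 h1 j hj h2
    · exact hr.max (fun j hj => (htop j hj).le) h3 hi.le j hj
  · intro i hi h1 j hj h2
    rcases lt_or_ge i s with h3 | h3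
    · exact h.south i h3 h1 j hj h2
    · have := hstep i h3 hi
      omega

lemma pdWord_vrun (ℓ : ℤ) : PDWord (vrun ℓ) := by
  unfold vrun
  split_ifs
  exacts [pdWord_replicate _ (by simp), pdWord_replicate _ (by simp)]

lemma pdWord_weSteps (ℓs : List ℤ) : PDWord (weSteps ℓs) := by
  induction ℓs with
  | nil => simpa [weSteps] using pdWord_nil
  | cons ℓ ℓs ih =>
    cases ℓs with
    | nil => rw [weSteps_singleton]; exact pdWord_vrun ℓ
    | cons ℓ' ℓs => rw [weSteps_cons_cons]; exact (pdWord_vrun ℓ).append_east ih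

lemma pt_vrun_lt {ℓ C : ℤ} (hC : 0 < C) (hℓ : ℓ ≤ C) {m : ℕ} (hm : m < (vrun ℓ).length) :
    (pt (vrun ℓ) m).2 < C := by
  unfold vrun at *
  rw [List.length_replicate] at hm
  rw [pt_replicate _ hm.le]
  split_ifs with h
  · simp; omega
  · simp; omega

lemma pt_weSteps_lt_of_take {ℓs : List ℤ} {C : ℤ} (h : ∀ i < ℓs.length, (ℓs.take i).sum < C)
    (hC : ℓs.sum ≤ C) {m : ℕ} (hm : m < (weSteps ℓs).length) : (pt (weSteps ℓs) m).2 < C := by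
  induction ℓs generalizing C m with
  | nil => simp [weSteps] at hm
  | cons ℓ ℓs ih =>
    have h0 : 0 < C := by simpa using h 0 (by simp)
    cases ℓs with
    | nil =>
      rw [weSteps_singleton] at *
      exact pt_vrun_lt h0 (by simpa using hC) hm
    | cons ℓ' ℓs =>
      have h1 : ℓ < C := by simpa using h 1 (by simp)
      rw [weSteps_cons_cons] at *
      rcases lt_trichotomy m (vrun ℓ).length with h2 | h2 | h2
      · rw [pt_append_left _ _ h2.le]
        exact pt_vrun_lt h0 h1.le h2
      · have := pt_append_right (vrun ℓ) ((1, 0) :: weSteps (ℓ' :: ℓs)) 0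
        rw [add_zero, ← h2, sum_vrun] at this
        rw [this]
        simpa [pt] using h1
      · obtain ⟨m', rfl⟩ : ∃ m', m = (vrun ℓ).length + (m' + 1) := ⟨m - (vrun ℓ).length - 1, by omega⟩
        rw [pt_append_right, sum_vrun]
        have h3 := ih (C := C - ℓ) (m := m')
          (fun i hi => by
            have := h (i + 1) (by simpa using hi)
            rw [List.take_succ_cons, List.sum_cons] at this
            omega)
          (by rw [List.sum_cons] at hC; omega) (by simp at hm; omega)
        simp only [pt, List.take_succ_cons, List.sum_cons, Prod.snd_add] at h3 ⊢
        omega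

/-- Concatenations of oriented blocks are prudent. -/
lemma prudentSeq_of_neSteps {x y : ℕ → ℤ} {s L : ℕ} (bs : List (List ℤ)) (h : PrudentSeq x y s)
    (hsL : s ≤ L) (htop : ∀ j < s, y j < y s) (hright : ∀ j ≤ s, x j ≤ x s)
    (hseg : seg y x s L = neSteps true bs) (hne : ∀ ℓs ∈ bs, weSteps ℓs ≠ [])
    (hexit : ∀ ℓs ∈ bs.dropLast, upperExit ℓs) : PrudentSeq x y L := by
  induction bs generalizing x y s with
  | nil =>
    have := congrArg List.length hseg
    simp [neSteps] at this
    obtain rfl : s = L := by omega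
    exact h
  | cons ℓs bs ih =>
    have hlen := congrArg List.length hseg
    simp only [neSteps, blockSteps, length_seg, List.length_append] at hlen
    have hpos := List.length_pos_iff.2 (hne ℓs List.mem_cons_self)
    set t := s + (weSteps ℓs).length with ht
    have hst : s ≤ t := by omega
    have htL : t ≤ L := by omega
    rw [← seg_append y x hst htL, neSteps] at hseg
    obtain ⟨e1, e2⟩ := List.append_inj hseg (by rw [length_seg]; simp [blockSteps]; omega)
    have e1 : seg y x s t = weSteps ℓs := e1
    have hpd : PDWord (seg y x s t) := e1 ▸ pdWord_weSteps ℓs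
    have hP := h.extend hst htop hpd
    rcases bs with - | ⟨ℓs', bs⟩
    · have := congrArg List.length e2
      simp [neSteps] at this
      obtain rfl : t = L := by omega
      exact hP
    · have hex := hexit ℓs (by simp)
      have hr : Rising y s t := by
        intro i h1 h2
        have := hpd.1 (y (i + 1) - y i, x (i + 1) - x i)
          (List.mem_map.2 ⟨i, List.mem_range'_1.2 (by omega), rfl⟩)
        simp only [Prod.mk.injEq] at this
        omega
      have hblock : ∀ j, s ≤ j → j < t → x j < x t := by
        intro j h1 h2
        have h3 := pt_weSteps_lt_of_take hex le_rfl (m := j - s) (by omega)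
        rw [← sum_weSteps_snd, ← e1, pt_seg _ _ _ _ _ (by omega), sum_seg _ _ hst,
          Nat.add_sub_cancel' h1] at h3
        simp only at h3
        omega
      refine (ih hP.swap htL ?_ ?_ ?_ (fun ℓs hm => hne ℓs (List.mem_cons_of_mem _ hm)) ?_).swap
      · intro j hj
        rcases lt_or_ge j s with h1 | h1
        · have := hright j h1.le
          have := hblock s le_rfl (by omega)
          omega
        · exact hblock j h1 hj
      · exact hr.max (fun j hj => (htop j hj).le) hst le_rfl
      · have : seg x y t L = (seg y x t L).map fun p => (p.2, p.1) := by simp [seg]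
        rw [this, e2, map_swap_neSteps]
        rfl
      · intro ℓs'' hm
        exact hexit ℓs'' (by rw [List.dropLast_cons_of_ne_nil (by simp)]; exact List.mem_cons_of_mem _ hm)

lemma DirWord.map_swap {l : List (ℤ × ℤ)} (h : DirWord l) :
    DirWord (l.map fun p => (p.2, p.1)) := by
  intro d hd
  obtain ⟨e, he, rfl⟩ := List.mem_map.1 hd
  obtain ⟨k, rfl⟩ := h e he
  fin_cases k
  exacts [⟨2, rfl⟩, ⟨3, rfl⟩, ⟨0, rfl⟩, ⟨1, rfl⟩]

lemma dirWord_neSteps (b : Bool) (bs : List (List ℤ)) : DirWord (neSteps b bs) := by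
  induction bs generalizing b with
  | nil => simp [neSteps, DirWord]
  | cons ℓs bs ih =>
    intro d hd
    rcases List.mem_append.1 hd with hd | hd
    · cases b with
      | true => exact (pdWord_weSteps ℓs).dirWord d hd
      | false =>
        change d ∈ snSteps ℓs at hd
        rw [← map_swap_weSteps] at hd
        exact (pdWord_weSteps ℓs).dirWord.map_swap d hd
    · exact ih _ d hd

lemma weSteps_ne_nil {ℓs : List ℤ} (hne : ℓs ≠ []) (h : ℓs.headI < 0) : weSteps ℓs ≠ [] := by
  obtain ⟨ℓ, ℓs, rfl⟩ := List.exists_cons_of_ne_nil hne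
  obtain ⟨R, hR⟩ := exists_weSteps_cons ℓs
  rw [hR]
  simp only [List.headI_cons] at h
  simp [vrun]
  omega

/-- A sequence of oriented blocks in which only the last one may violate the upper exit condition
is an NE-prudent path. -/
lemma isNEPath_of_blocks {bs : List (List ℤ)} (hbs : bs ≠ [])
    (hne : ∀ ℓs ∈ bs, ℓs ≠ [] ∧ ℓs.headI < 0) (hexit : ∀ ℓs ∈ bs.dropLast, upperExit ℓs) :
    IsNEPath (neSteps true bs) := by
  refine ⟨isPrudent_of_prudentSeq (dirWord_neSteps _ _) ?_, true, bs, ⟨hbs,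
    fun ℓs hm => (hne ℓs hm).1, ?_, ?_⟩, rfl⟩
  · apply PrudentSeq.swap
    refine prudentSeq_of_neSteps (s := 0) bs ⟨?_, ?_, ?_, ?_, ?_⟩ (Nat.zero_le _) ?_ ?_
      (eq_seg_pt _) (fun ℓs hm => weSteps_ne_nil (hne ℓs hm).1 (hne ℓs hm).2) hexit
    all_goals simp
  · intro i hi
    rw [List.getD_eq_getElem _ _ (by omega)]
    apply hexit
    rw [List.mem_iff_getElem]
    exact ⟨i, by rw [List.length_dropLast]; omega, List.getElem_dropLast _⟩
  · intro i _ hi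
    rw [List.getD_eq_getElem _ _ hi]
    exact (hne _ (List.getElem_mem hi)).2

/-! ## Assembling the image path -/

lemma LatticeSym.exists_inv {g : ℤ × ℤ → ℤ × ℤ} (hg : LatticeSym g) :
    ∃ g', LatticeSym g' ∧ ∀ p, g' (g p) = p := by
  induction hg with
  | id => exact ⟨_, LatticeSym.id, fun _ => rfl⟩
  | swap _ ih =>
    obtain ⟨g', h1, h2⟩ := ih
    exact ⟨_, h1.comp_swap, fun p => h2 p⟩
  | neg _ ih =>
    obtain ⟨g', h1, h2⟩ := ih
    exact ⟨_, h1.comp_neg, fun p => by simpa using h2 p⟩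

/-- The word `l` is obtained from a piece of `w` by relabelling the letters. -/
def Copies (w l : List (ℤ × ℤ)) : Prop :=
  ∃ m f, ∃ k : Fin 4 → Fin 4, m <:+: w ∧ (∀ d, f (dirs d) = dirs (k d)) ∧ l = m.map f

lemma Copies.mono {w w' l : List (ℤ × ℤ)} (h : Copies w l) (hw : w <:+: w') : Copies w' l := by
  obtain ⟨m, f, k, h1, h2, h3⟩ := h
  exact ⟨m, f, k, h1.trans hw, h2, h3⟩

lemma Copies.map_swap {w l : List (ℤ × ℤ)} (h : Copies w l) :
    Copies (w.map fun p => (p.2, p.1)) l := by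
  obtain ⟨m, f, k, h1, h2, h3⟩ := h
  refine ⟨m.map fun p => (p.2, p.1), fun p => f (p.2, p.1), k ∘ ![2, 3, 0, 1], h1.map _, ?_, ?_⟩
  · intro d
    rw [Function.comp_apply, ← h2]
    fin_cases d <;> rfl
  · rw [h3]
    simp

lemma copies_of_sym {l : List (ℤ × ℤ)} {g : ℤ × ℤ → ℤ × ℤ} (hg : LatticeSym g) :
    Copies (l.map g) l := by
  obtain ⟨g', h1, h2⟩ := hg.exists_inv
  obtain ⟨k, hk⟩ := h1.exists_perm
  have h3 : g' ∘ g = id := funext h2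
  exact ⟨l.map g, g', k, List.infix_rfl, hk, by simp [h3]⟩

lemma copies_replicate {w : List (ℤ × ℤ)} (d : Fin 4) {n : ℕ} (hn : n ≤ w.length) :
    Copies w (List.replicate n (dirs d)) :=
  ⟨w.take n, fun _ => dirs d, fun _ => d, (List.take_prefix n w).isInfix, fun _ => rfl,
    by simp [hn]⟩

lemma neSteps_append (b : Bool) (bs bs' : List (List ℤ)) :
    neSteps b (bs ++ bs') = neSteps b bs ++ neSteps true bs' ∨
    neSteps b (bs ++ bs') = neSteps b bs ++ (neSteps true bs').map fun p => (p.2, p.1) := by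
  induction bs generalizing b with
  | nil =>
    cases b
    · right; simp [neSteps, map_swap_neSteps]
    · left; simp [neSteps]
  | cons ℓs bs ih =>
    rcases ih (!b) with h | h
    · left; simp [neSteps, h]
    · right; simp [neSteps, h]

lemma length_neSteps_append (b : Bool) (bs bs' : List (List ℤ)) :
    (neSteps b (bs ++ bs')).length = (neSteps b bs).length + (neSteps true bs').length := by
  rcases neSteps_append b bs bs' with h | h <;> simp [h]

lemma ham_neSteps_append (b : Bool) (bs bs' : List (List ℤ)) :
    Ham (neSteps b bs) + Ham (neSteps true bs') ≤ Ham (neSteps b (bs ++ bs')) := by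
  rcases neSteps_append b bs bs' with h | h
  · rw [h]; exact ham_append_ge _ _
  · rw [h, ← ham_map_swap (neSteps true bs')]; exact ham_append_ge _ _

lemma copies_neSteps_left {b : Bool} {bs bs' : List (List ℤ)} {l : List (ℤ × ℤ)}
    (h : Copies (neSteps b bs) l) : Copies (neSteps b (bs ++ bs')) l := by
  rcases neSteps_append b bs bs' with e | e <;> rw [e]
  · exact h.mono (List.prefix_append _ _).isInfix
  · exact h.mono (List.prefix_append _ _).isInfix

lemma copies_neSteps_right {b : Bool} {bs bs' : List (List ℤ)} {l : List (ℤ × ℤ)}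
    (h : Copies (neSteps true bs') l) : Copies (neSteps b (bs ++ bs')) l := by
  rcases neSteps_append b bs bs' with e | e <;> rw [e]
  · exact h.mono (List.suffix_append _ _).isInfix
  · exact h.map_swap.mono (List.suffix_append _ _).isInfix

/-- Sorting chunks by kind: the oriented blocks `B`, the partially directed pieces `P` and the
total number `T` of line steps. -/
lemma exists_sorted (cs : List (Kind × List (ℤ × ℤ))) (hcs : ∀ p ∈ cs, ValidChunk p) :
    ∃ (B : List (List ℤ)) (P : List (List (ℤ × ℤ))) (T : ℕ), Genuine B ∧ (∀ p ∈ P, PDWord p) ∧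
      (cs.map Prod.snd).flatten.length = (neSteps true B).length + T + P.flatten.length ∧
      (cs.map chunkEnergy).sum ≤ Ham (neSteps true B) + 2 * T + (P.map Ham).sum ∧
      (cs.map chunkDemand).sum = 2 * P.length - T ∧ P.length ≤ cs.length ∧
      ∀ c ∈ cs, (∃ d n, n ≤ T ∧ c.2 = List.replicate n (dirs d)) ∨ (∃ p ∈ P, Copies p c.2) ∨
        Copies (neSteps true B) c.2 := by
  induction cs with
  | nil => exact ⟨[], [], 0, by simp [Genuine], by simp, by simp [neSteps], by simp, by simp,
      by simp, by simp⟩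
  | cons q cs ih =>
    obtain ⟨B, P, T, h1, h2, h3, h4, h5, h6, h7⟩ := ih fun p hp => hcs p (List.mem_cons_of_mem _ hp)
    have hq := hcs q List.mem_cons_self
    obtain ⟨kd, l⟩ := q
    cases kd with
    | line =>
      obtain ⟨d, n, rfl⟩ := hq
      refine ⟨B, P, T + n, h1, h2, ?_, ?_, ?_, ?_, ?_⟩
      · simp at h3 ⊢; omega
      · simp [chunkEnergy]; omega
      · simp [chunkDemand]; omega
      · simp; omega
      · intro c hc
        rcases List.mem_cons.1 hc with rfl | hc
        · exact Or.inl ⟨d, n, by omega, rfl⟩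
        · rcases h7 c hc with ⟨d', n', h8, h9⟩ | h8 | h8
          exacts [Or.inl ⟨d', n', by omega, h9⟩, Or.inr (Or.inl h8), Or.inr (Or.inr h8)]
    | pd =>
      obtain ⟨g, hg, hl⟩ := hq
      refine ⟨B, l.map g :: P, T, h1, ?_, ?_, ?_, ?_, ?_, ?_⟩
      · intro p hp
        rcases List.mem_cons.1 hp with rfl | hp
        exacts [hl, h2 p hp]
      · simp at h3 ⊢; omega
      · simp [chunkEnergy, hg.ham_map]; omega
      · simp [chunkDemand]; omega
      · simp; omega
      · intro c hc
        rcases List.mem_cons.1 hc with rfl | hc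
        · exact Or.inr (Or.inl ⟨_, List.mem_cons_self, copies_of_sym hg⟩)
        · rcases h7 c hc with h8 | ⟨p, hp, h8⟩ | h8
          exacts [Or.inl h8, Or.inr (Or.inl ⟨p, List.mem_cons_of_mem _ hp, h8⟩), Or.inr (Or.inr h8)]
    | ne =>
      obtain ⟨g, hg, bs, hb, hl⟩ := hq
      have hlen := length_neSteps_append true bs B
      have hham := ham_neSteps_append true bs B
      have hlen' := congrArg List.length hl
      rw [List.length_map] at hlen'
      have hham' := congrArg Ham hl
      rw [hg.ham_map] at hham'
      refine ⟨bs ++ B, P, T, ?_, h2, ?_, ?_, ?_, ?_, ?_⟩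
      · intro ℓs hm
        rcases List.mem_append.1 hm with hm | hm
        exacts [hb _ hm, h1 _ hm]
      · simp at h3 ⊢; omega
      · simp [chunkEnergy]; omega
      · simp [chunkDemand]; omega
      · simp; omega
      · intro c hc
        rcases List.mem_cons.1 hc with rfl | hc
        · refine Or.inr (Or.inr (copies_neSteps_left ?_))
          rw [hl]
          exact copies_of_sym hg
        · rcases h7 c hc with h8 | h8 | h8
          exacts [Or.inl h8, Or.inr (Or.inl h8), Or.inr (Or.inr (copies_neSteps_right h8))]

lemma isNEPath_nil : IsNEPath [] := by
  refine ⟨by simp [IsPrudent], true, [[0]], ⟨by simp, by simp, ?_, ?_⟩, ?_⟩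
  · intro i hi; simp at hi
  · intro i h1 h2; simp at h2; omega
  · simp [neSteps, blockSteps, weSteps_singleton, vrun]

lemma sum_ham_le (P : List (List (ℤ × ℤ))) (z : List (ℤ × ℤ)) :
    Ham z + (P.map Ham).sum ≤ Ham (z ++ (P.map fun p => (1, 0) :: p).flatten) := by
  induction P generalizing z with
  | nil => simp
  | cons p P ih =>
    have h1 := ih (z ++ (1, 0) :: p)
    have h2 := ham_append_ge z ((1, 0) :: p)
    have h3 := ham_append_ge [(1, 0)] p
    rw [List.singleton_append] at h3
    simp only [List.map_cons, List.sum_cons, List.flatten_cons]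
    rw [← List.append_assoc]
    omega

/-- From a decomposition to an NE-prudent path from which the original path can be copied. -/
lemma exists_image (cs : List (Kind × List (ℤ × ℤ))) (hcs : ∀ p ∈ cs, ValidChunk p)
    (hd : (cs.map chunkDemand).sum ≤ 0) (h : ℕ) :
    ∃ w, IsNEPath w ∧ DirWord w ∧ w.length = (cs.map Prod.snd).flatten.length ∧
      (∀ c ∈ cs, Copies w c.2) ∧
      (cs.map chunkEnergy).sum ≤ Ham w + 3 * (w.length / (h + 1)) + 3 * h + 2 + 2 * cs.length := by
  obtain ⟨B, P, T, h1, h2, h3, h4, h5, h6, h7⟩ := exists_sorted cs hcs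
  rcases Nat.eq_zero_or_pos T with rfl | hT
  · obtain rfl : P = [] := by
      rw [← List.length_eq_zero_iff]
      omega
    have hcopies : ∀ c ∈ cs, Copies (neSteps true B) c.2 := by
      intro c hc
      rcases h7 c hc with ⟨d, n, h8, h9⟩ | ⟨p, hp, _⟩ | h8
      · rw [h9]; exact copies_replicate d (by omega)
      · simp at hp
      · exact h8
    refine ⟨neSteps true B, ?_, dirWord_neSteps _ _, by simpa using h3.symm, hcopies, ?_⟩
    · rcases eq_or_ne B [] with rfl | hB
      · exact isNEPath_nil
      · exact isNEPath_of_blocks hB (fun ℓs hm => ⟨(h1 ℓs hm).1, (h1 ℓs hm).2.1⟩)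
          fun ℓs hm => (h1 ℓs (List.mem_of_mem_dropLast hm)).2.2
    · simp at h4; omega
  · obtain ⟨z, z1, z2, z3, z4⟩ := exists_dense h (T - P.length) (by omega)
    obtain ⟨ℓ, ℓs, e1, e2, -⟩ := (z1.append_flatten P h2).exists_stretches
    have hℓ : ℓ < 0 := e2.2 (by rw [List.head?_append, z2]; rfl)
    set F := z ++ (P.map fun p => (1, 0) :: p).flatten with hF
    have hlast : neSteps true [ℓ :: ℓs] = F := by simp [neSteps, blockSteps, e1]
    have hFlen : F.length = T + P.flatten.length := by
      have : ((P.map fun p => ((1, 0) :: p : List (ℤ × ℤ))).flatten).length =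
          P.length + P.flatten.length := by
        clear * -
        induction P with
        | nil => simp
        | cons p P ih =>
          simp only [List.map_cons, List.flatten_cons, List.length_append, List.length_cons, ih]
          omega
      rw [hF, List.length_append, this, z3]
      omega
    have hFham := sum_ham_le P z
    rw [← hF] at hFham
    have hlen := length_neSteps_append true B [ℓ :: ℓs]
    have hham := ham_neSteps_append true B [ℓ :: ℓs]
    rw [hlast] at hlen hham
    refine ⟨neSteps true (B ++ [ℓ :: ℓs]), ?_, dirWord_neSteps _ _, by omega, ?_, ?_⟩
    · refine isNEPath_of_blocks (by simp) (fun ℓs' hm => ?_) fun ℓs' hm => ?_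
      · rcases List.mem_append.1 hm with hm | hm
        · exact ⟨(h1 ℓs' hm).1, (h1 ℓs' hm).2.1⟩
        · obtain rfl := List.mem_singleton.1 hm
          exact ⟨by simp, hℓ⟩
      · rw [List.dropLast_concat] at hm
        exact (h1 ℓs' hm).2.2
    · intro c hc
      rcases h7 c hc with ⟨d, n, h8, h9⟩ | ⟨p, hp, h8⟩ | h8
      · rw [h9]; exact copies_replicate d (by omega)
      · apply copies_neSteps_right
        rw [hlast]
        refine h8.mono ?_
        have i1 : p <:+: (1, 0) :: p := (List.suffix_cons _ _).isInfix
        have i2 : (1, 0) :: p <:+: (P.map fun p => (1, 0) :: p).flatten :=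
          List.infix_of_mem_flatten (List.mem_map.2 ⟨p, hp, rfl⟩)
        exact i1.trans (i2.trans (List.suffix_append _ _).isInfix)
      · exact copies_neSteps_left h8
    · have : (T - P.length) / (h + 1) ≤ (neSteps true (B ++ [ℓ :: ℓs])).length / (h + 1) :=
        Nat.div_le_div_right (by omega)
      omega

/-! ## Encoding and counting -/

lemma dirs_injective : Function.Injective dirs := by decide

lemma stepsOf_injective {L : ℕ} : Function.Injective (stepsOf (L := L)) := fun _ _ h =>
  List.ofFn_injective ((List.map_injective_iff.2 dirs_injective) h)

lemma length_stepsOf {L : ℕ} (s : Fin L → Fin 4) : (stepsOf s).length = L := by simp [stepsOf]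

lemma dirWord_stepsOf {L : ℕ} (s : Fin L → Fin 4) : DirWord (stepsOf s) := by
  intro d hd
  obtain ⟨k, -, rfl⟩ := List.mem_map.1 hd
  exact ⟨k, rfl⟩

lemma DirWord.exists_stepsOf {L : ℕ} {w : List (ℤ × ℤ)} (hw : DirWord w) (hL : w.length = L) :
    ∃ t : Fin L → Fin 4, stepsOf t = w := by
  subst hL
  choose t ht using fun i : Fin w.length => hw w[i] (List.getElem_mem _)
  refine ⟨t, ?_⟩
  rw [stepsOf, List.map_ofFn]
  conv_rhs => rw [← List.ofFn_getElem (xs := w)]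
  congr 1
  funext i
  exact (ht i).symm

/-- The piece of `t` starting at `d.1`, of length `d.2.1`, relabelled by `d.2.2`. -/
def piece {L : ℕ} (t : Fin L → Fin 4) (d : Fin (L + 1) × Fin (L + 1) × (Fin 4 → Fin 4)) :
    List (ℤ × ℤ) :=
  (((List.ofFn t).drop d.1).take d.2.1).map (dirs ∘ d.2.2)

lemma Copies.exists_piece {L : ℕ} {t : Fin L → Fin 4} {l : List (ℤ × ℤ)}
    (h : Copies (stepsOf t) l) : ∃ d, piece t d = l := by
  obtain ⟨m, f, k, ⟨u, v, huv⟩, hf, rfl⟩ := h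
  have hlen := congrArg List.length huv
  simp only [List.length_append, length_stepsOf] at hlen
  refine ⟨(⟨u.length, by omega⟩, ⟨m.length, by omega⟩, k), ?_⟩
  have hm : m = ((stepsOf t).drop u.length).take m.length := by
    rw [← huv]
    simp
  have hk : dirs ∘ k = f ∘ dirs := funext fun d => (hf d).symm
  conv_rhs => rw [hm]
  simp [piece, stepsOf, hk, List.map_take, List.map_drop, Function.comp_assoc]

lemma exists_flatten_ofFn {α β : Type*} (g : α → List β) (d₀ : α) (h₀ : g d₀ = []) (m : ℕ)
    (ls : List (List β)) (hm : ls.length ≤ m) (hls : ∀ l ∈ ls, ∃ d, g d = l) :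
    ∃ e : Fin m → α, (List.ofFn fun i => g (e i)).flatten = ls.flatten := by
  induction m generalizing ls with
  | zero => exact ⟨Fin.elim0, by simp [List.length_eq_zero_iff.1 (Nat.le_zero.1 hm)]⟩
  | succ m ih =>
    cases ls with
    | nil => exact ⟨fun _ => d₀, by simp [h₀]⟩
    | cons l ls =>
      obtain ⟨e, he⟩ := ih ls (by simpa using hm) fun l hl => hls l (List.mem_cons_of_mem _ hl)
      obtain ⟨d, hd⟩ := hls l List.mem_cons_self
      exact ⟨Fin.cons d e, by simp [List.ofFn_succ, hd, he]⟩

/-- `s` is cut into at most `m` pieces, each of them copied from `t`. -/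
def Assembled {L : ℕ} (t : Fin L → Fin 4) (m : ℕ) (s : Fin L → Fin 4) : Prop :=
  ∃ ls : List (List (ℤ × ℤ)), ls.length ≤ m ∧ ls.flatten = stepsOf s ∧ ∀ l ∈ ls, Copies (stepsOf t) l

lemma card_le_of_assembled {L m : ℕ} (t : Fin L → Fin 4) (S : Finset (Fin L → Fin 4))
    (hS : ∀ s ∈ S, Assembled t m s) : S.card ≤ (256 * (L + 1) ^ 2) ^ m := by
  have key : ∀ s ∈ S, ∃ e : Fin m → Fin (L + 1) × Fin (L + 1) × (Fin 4 → Fin 4),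
      (List.ofFn fun i => piece t (e i)).flatten = stepsOf s := by
    intro s hs
    obtain ⟨ls, h1, h2, h3⟩ := hS s hs
    rw [← h2]
    exact exists_flatten_ofFn (piece t) (0, 0, id) (by simp [piece]) m ls h1
      fun l hl => (h3 l hl).exists_piece
  choose! e he using key
  calc S.card ≤ (Finset.univ :
        Finset (Fin m → Fin (L + 1) × Fin (L + 1) × (Fin 4 → Fin 4))).card := by
        refine Finset.card_le_card_of_injOn e (fun _ _ => Finset.mem_coe.2 (Finset.mem_univ _)) ?_
        intro s hs s' hs' h
        apply stepsOf_injective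
        rw [← he s hs, ← he s' hs', h]
    _ = (256 * (L + 1) ^ 2) ^ m := by
        simp only [Finset.card_univ, Fintype.card_fun, Fintype.card_prod, Fintype.card_fin]
        congr 1
        ring

lemma cast_card_le_of_assembled {L m : ℕ} (t : Fin L → Fin 4) (S : Finset (Fin L → Fin 4))
    (hS : ∀ s ∈ S, Assembled t m s) :
    (S.card : ℝ) ≤ Real.exp (m * Real.log (256 * ((L : ℝ) + 1) ^ 2)) := by
  rw [Real.exp_nat_mul, Real.exp_log (by positivity)]
  exact_mod_cast card_le_of_assembled t S hS

/-! ## The image of a prudent path -/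

lemma exists_ne_assembled {L r : ℕ} (hr : 1 ≤ r) (hL : L < r ^ 6) {s : Fin L → Fin 4}
    (hs : s ∈ psawFinset L) :
    ∃ t ∈ neFinset L, Assembled t (37 * r ^ 5) s ∧
      Ham (stepsOf s) ≤ Ham (stepsOf t) + 138 * r ^ 5 := by
  have hp := prudentSeq_of_isPrudent (dirWord_stepsOf s) (by simpa [psawFinset] using hs)
  obtain ⟨nd, ns, N, E, ⟨cs, h1, h2, h3, h4, h5⟩, hnd, hns, hN, hE⟩ :=
    hp.exists_decomp (r ^ 2) (r ^ 3) hr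
  rw [addedEnergy_eq] at h4
  rw [eq_seg_pt] at h1 h4
  rw [length_stepsOf] at hnd hns hN
  obtain ⟨w, hw1, hw2, hw3, hw4, hw5⟩ := exists_image cs h2 h5 (r ^ 3)
  rw [h1, length_stepsOf] at hw3
  obtain ⟨t, rfl⟩ := hw2.exists_stepsOf hw3
  have hpow : ∀ k, 1 ≤ r ^ k := fun k => Nat.one_le_pow _ _ hr
  have e3 : r ^ 3 ≤ r ^ 5 := Nat.pow_le_pow_right hr (by norm_num)
  have e4 : r ^ 4 ≤ r ^ 5 := Nat.pow_le_pow_right hr (by norm_num)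
  have e34 : r ^ 3 ≤ r ^ 4 := Nat.pow_le_pow_right hr (by norm_num)
  have e36 : r ^ 3 ≤ r ^ 6 := Nat.pow_le_pow_right hr (by norm_num)
  have hnd' : nd ≤ r ^ 4 := by
    refine Nat.le_of_mul_le_mul_right (c := r ^ 2) ?_ (hpow 2)
    have : r ^ 4 * r ^ 2 = r ^ 6 := by ring
    omega
  have hns' : ns ≤ 4 * r ^ 3 := by
    refine Nat.le_of_mul_le_mul_right (c := r ^ 3) ?_ (hpow 3)
    have : 2 * r ^ 3 * r ^ 3 = 2 * r ^ 6 := by ring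
    have : 4 * r ^ 3 * r ^ 3 = 4 * r ^ 6 := by ring
    omega
  have hN' : N ≤ 37 * r ^ 5 := by
    refine Nat.le_of_mul_le_mul_left (c := r) ?_ hr
    have : 7 * r * (nd + ns) ≤ 7 * r * (5 * r ^ 4) := Nat.mul_le_mul_left _ (by omega)
    have : 7 * r * (5 * r ^ 4) = 35 * r ^ 5 := by ring
    have : r * (37 * r ^ 5) = 37 * r ^ 6 := by ring
    have : r ^ 5 ≤ r ^ 6 := Nat.pow_le_pow_right hr (by norm_num)
    omega
  have hE' : E ≤ 56 * r ^ 5 := by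
    have : 8 * r * (nd + ns) ≤ 8 * r * (5 * r ^ 4) := Nat.mul_le_mul_left _ (by omega)
    have : 8 * r * (5 * r ^ 4) = 40 * r ^ 5 := by ring
    have : 4 * r ^ 2 * ns ≤ 4 * r ^ 2 * (4 * r ^ 3) := Nat.mul_le_mul_left _ hns'
    have : 4 * r ^ 2 * (4 * r ^ 3) = 16 * r ^ 5 := by ring
    omega
  have hdiv : L / (r ^ 3 + 1) ≤ r ^ 3 := by
    refine Nat.le_of_lt_succ (Nat.div_lt_of_lt_mul ?_)
    have : (r ^ 3 + 1) * (r ^ 3).succ = r ^ 6 + 2 * r ^ 3 + 1 := by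
      rw [Nat.succ_eq_add_one]
      ring
    omega
  refine ⟨t, by simpa [neFinset] using hw1, ⟨cs.map Prod.snd, by simpa using h3.trans hN', h1, ?_⟩, ?_⟩
  · intro l hl
    obtain ⟨c, hc, rfl⟩ := List.mem_map.1 hl
    exact hw4 c hc
  · rw [length_stepsOf] at hw5
    have := hpow 5
    omega

/-! ## Sublinear bounds -/

/-- A natural number slightly larger than the sixth root of `L`. -/
noncomputable def rootScale (L : ℕ) : ℕ := ⌊(L : ℝ) ^ (1 / 6 : ℝ)⌋₊ + 1

lemma lt_rootScale_pow (L : ℕ) : L < rootScale L ^ 6 := by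
  have h : (L : ℝ) ^ (1 / 6 : ℝ) < rootScale L := by
    rw [rootScale, Nat.cast_add_one]
    exact Nat.lt_floor_add_one _
  have h' := pow_lt_pow_left₀ h (by positivity) (n := 6) (by norm_num)
  rw [← Real.rpow_natCast, ← Real.rpow_mul (by positivity)] at h'
  norm_num at h'
  exact_mod_cast h'

lemma rootScale_pow_le {L : ℕ} (hL : 1 ≤ L) :
    (rootScale L : ℝ) ^ 5 ≤ 32 * (L : ℝ) ^ (5 / 6 : ℝ) := by
  have hL' : (1 : ℝ) ≤ L := by exact_mod_cast hL
  have h : (rootScale L : ℝ) ≤ 2 * (L : ℝ) ^ (1 / 6 : ℝ) := by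
    have h1 := Nat.floor_le (a := (L : ℝ) ^ (1 / 6 : ℝ)) (by positivity)
    have h2 := Real.one_le_rpow hL' (z := 1 / 6) (by norm_num)
    rw [rootScale, Nat.cast_add_one]
    linarith
  calc (rootScale L : ℝ) ^ 5 ≤ (2 * (L : ℝ) ^ (1 / 6 : ℝ)) ^ 5 := by gcongr
    _ = 32 * (L : ℝ) ^ (5 / 6 : ℝ) := by
      rw [mul_pow, ← Real.rpow_natCast ((L : ℝ) ^ (1 / 6 : ℝ)), ← Real.rpow_mul (by positivity)]
      norm_num

lemma tendsto_div_of_le_rpow {f : ℕ → ℝ} {K a : ℝ} (ha : a < 1) (h0 : ∀ L, 0 ≤ f L)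
    (h : ∀ L : ℕ, 1 ≤ L → f L ≤ K * (L : ℝ) ^ a) :
    Tendsto (fun L : ℕ => f L / (L : ℝ)) atTop (nhds 0) := by
  have hlim : Tendsto (fun L : ℕ => K * (L : ℝ) ^ (-(1 - a))) atTop (nhds 0) := by
    simpa using ((tendsto_rpow_neg_atTop (sub_pos.2 ha)).comp
      tendsto_natCast_atTop_atTop).const_mul K
  refine squeeze_zero' (Eventually.of_forall fun L => div_nonneg (h0 L) L.cast_nonneg) ?_ hlim
  filter_upwards [eventually_ge_atTop 1] with L hL
  have hL' : (0 : ℝ) < L := by exact_mod_cast hL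
  rw [div_le_iff₀ hL', mul_assoc, ← Real.rpow_add_one hL'.ne']
  simpa using h L hL

lemma log_card_le {L : ℕ} (hL : 1 ≤ L) :
    Real.log (256 * ((L : ℝ) + 1) ^ 2) ≤ 24 * 1024 ^ (1 / 24 : ℝ) * (L : ℝ) ^ (1 / 12 : ℝ) := by
  have hL' : (1 : ℝ) ≤ L := by exact_mod_cast hL
  have h : 256 * ((L : ℝ) + 1) ^ 2 ≤ 1024 * (L : ℝ) ^ 2 := by nlinarith
  calc Real.log (256 * ((L : ℝ) + 1) ^ 2) ≤ Real.log (1024 * (L : ℝ) ^ 2) :=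
        Real.log_le_log (by positivity) h
    _ ≤ (1024 * (L : ℝ) ^ 2) ^ (1 / 24 : ℝ) / (1 / 24) :=
        Real.log_le_rpow_div (by positivity) (by norm_num)
    _ = 24 * 1024 ^ (1 / 24 : ℝ) * (L : ℝ) ^ (1 / 12 : ℝ) := by
        rw [Real.mul_rpow (by norm_num) (by positivity), ← Real.rpow_natCast (L : ℝ) 2,
          ← Real.rpow_mul (by positivity)]
        norm_num
        ring

/-- There are sub-linear functions `f₁, f₂` and, for every `L`, a map
`M_L : Ω_L^PSAW → Ω_L^NE` such that every `ŵ ∈ Ω_L^NE` has at most `e^{f₁(L)}`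
preimages and `H(w) − H(M_L(w)) ≤ f₂(L)` for every `w ∈ Ω_L^PSAW`. -/
theorem exists_map_to_NE :
    ∃ f₁ f₂ : ℕ → ℝ, (∀ L, 0 ≤ f₁ L) ∧ (∀ L, 0 ≤ f₂ L) ∧
      Tendsto (fun L : ℕ => f₁ L / (L : ℝ)) atTop (nhds 0) ∧
      Tendsto (fun L : ℕ => f₂ L / (L : ℝ)) atTop (nhds 0) ∧
      ∀ L : ℕ, ∃ M : (Fin L → Fin 4) → (Fin L → Fin 4),
        (∀ s ∈ psawFinset L, M s ∈ neFinset L) ∧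
        (∀ t ∈ neFinset L,
          (((psawFinset L).filter fun s => M s = t).card : ℝ) ≤ Real.exp (f₁ L)) ∧
        (∀ s ∈ psawFinset L,
          (Ham (stepsOf s) : ℝ) - (Ham (stepsOf (M s)) : ℝ) ≤ f₂ L) := by
  have hlog : ∀ L : ℕ, 0 ≤ Real.log (256 * ((L : ℝ) + 1) ^ 2) := fun L =>
    Real.log_nonneg (by nlinarith [(L.cast_nonneg : (0 : ℝ) ≤ L)])
  have h₁ : ∀ L : ℕ, 0 ≤ 37 * (rootScale L : ℝ) ^ 5 * Real.log (256 * ((L : ℝ) + 1) ^ 2) :=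
    fun L => mul_nonneg (by positivity) (hlog L)
  refine ⟨fun L => 37 * (rootScale L : ℝ) ^ 5 * Real.log (256 * ((L : ℝ) + 1) ^ 2),
    fun L => 138 * (rootScale L : ℝ) ^ 5, h₁, fun L => by positivity, ?_, ?_, ?_⟩
  · refine tendsto_div_of_le_rpow (K := 37 * 32 * (24 * 1024 ^ (1 / 24 : ℝ))) (a := 11 / 12)
      (by norm_num) h₁ fun L hL => ?_
    have hL' : (0 : ℝ) < L := by exact_mod_cast hL
    calc 37 * (rootScale L : ℝ) ^ 5 * Real.log (256 * ((L : ℝ) + 1) ^ 2)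
        ≤ 37 * (32 * (L : ℝ) ^ (5 / 6 : ℝ)) *
          (24 * 1024 ^ (1 / 24 : ℝ) * (L : ℝ) ^ (1 / 12 : ℝ)) := by
          have := hlog L
          gcongr
          · exact rootScale_pow_le hL
          · exact log_card_le hL
      _ = 37 * 32 * (24 * 1024 ^ (1 / 24 : ℝ)) *
          ((L : ℝ) ^ (5 / 6 : ℝ) * (L : ℝ) ^ (1 / 12 : ℝ)) := by ring
      _ = _ := by
          rw [← Real.rpow_add hL']
          norm_num
  · refine tendsto_div_of_le_rpow (K := 138 * 32) (a := 5 / 6) (by norm_num)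
      (fun L => by positivity) fun L hL => ?_
    have := rootScale_pow_le hL
    linarith
  · intro L
    have key := fun s (hs : s ∈ psawFinset L) =>
      exists_ne_assembled (Nat.le_add_left 1 _) (lt_rootScale_pow L) hs
    choose! M hM using key
    refine ⟨M, fun s hs => (hM s hs).1, fun t _ => ?_, fun s hs => ?_⟩
    · have hcard := cast_card_le_of_assembled (m := 37 * rootScale L ^ 5) t
        ((psawFinset L).filter fun s => M s = t) fun s hs => by
          rw [Finset.mem_filter] at hs
          exact hs.2 ▸ (hM s hs.1).2.1
      rwa [Nat.cast_mul, Nat.cast_pow, Nat.cast_ofNat] at hcard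
    · have := (hM s hs).2.2
      have : (Ham (stepsOf s) : ℝ) ≤ Ham (stepsOf (M s)) + 138 * (rootScale L : ℝ) ^ 5 := by
        exact_mod_cast this
      linarith
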